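/- arXiv:2311.09906 — 2 statements merged into one kernel-verified Lean document; each statement's English description precedes it below -/
import Mathlib

section
/- Let g be a finite-dimensional unimodular real Lie algebra of dimension 2n containing an abelian ideal a of codimension 2, and J a complex structure on g with J(a) ≠ a and [g,g] ⊄ a. If (g,J) admits a balanced Hermitian metric, then either J is degenerate (i.e. [J𝔟,a] ⊆ a_J) and [g,a] ⊆ 𝔟, or J is generic (i.e. [J𝔟,𝔟] ⊄ 𝔟) and σb > 0 for every choice of x ∈ 𝔟 \ a_J and y ∈ a with a = a_J ⊕ ℝx ⊕ ℝy, where σ, b are determined by [Jx,Jy] − σ·Jx ∈ a_J and [Jx,x] − (ax+by) ∈ a_J. In particular J is not half-generic (i.e. it is not the case that [J𝔟,𝔟] ⊆ 𝔟 and [J𝔟,a] ⊄ a_J). -/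
open Module

section Defs

variable {L : Type*} [LieRing L] [LieAlgebra ℝ L]

/-- A complex structure on a real Lie algebra: `J² = -id` plus integrability. -/
def IsComplexStructure (J : L →ₗ[ℝ] L) : Prop :=
  (∀ x : L, J (J x) = -x) ∧
  (∀ x y : L, ⁅x, y⁆ - ⁅J x, J y⁆ + J ⁅J x, y⁆ + J ⁅x, J y⁆ = 0)

/-- A Lie algebra is unimodular if every `ad x` is traceless. -/
def IsUnimodularLie (L : Type*) [LieRing L] [LieAlgebra ℝ L] : Prop :=
  ∀ x : L, LinearMap.trace ℝ L (LieAlgebra.ad ℝ L x) = 0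

/-- A Hermitian metric on `(L, J)`: a `J`-compatible inner product. -/
structure HermMetric (J : L →ₗ[ℝ] L) : Type _ where
  B : L →ₗ[ℝ] L →ₗ[ℝ] ℝ
  symm : ∀ x y : L, B x y = B y x
  posdef : ∀ x : L, x ≠ 0 → 0 < B x x
  compat : ∀ x y : L, B (J x) (J y) = B x y

variable {J : L →ₗ[ℝ] L}

/-- The Kähler form `ω(x,y) = ⟨Jx, y⟩`. -/
def HermMetric.omega (g : HermMetric J) (x y : L) : ℝ := g.B (J x) y

/-- Exterior differential of the Kähler form. -/
def HermMetric.dOmega (g : HermMetric J) (x y z : L) : ℝ :=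
  - g.omega ⁅x, y⁆ z + g.omega ⁅x, z⁆ y - g.omega ⁅y, z⁆ x

/-- `dᶜω (x,y,z) = -dω(Jx, Jy, Jz)`. -/
def HermMetric.dcOmega (g : HermMetric J) (x y z : L) : ℝ :=
  - g.dOmega (J x) (J y) (J z)

/-- `d(dᶜω)` as a 4-form. -/
def HermMetric.ddcOmega (g : HermMetric J) (x y z w : L) : ℝ :=
  - g.dcOmega ⁅x, y⁆ z w + g.dcOmega ⁅x, z⁆ y w - g.dcOmega ⁅x, w⁆ y z
  - g.dcOmega ⁅y, z⁆ x w + g.dcOmega ⁅y, w⁆ x z - g.dcOmega ⁅z, w⁆ x y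

/-- The metric is Kähler if `dω = 0`. -/
def HermMetric.IsKahler (g : HermMetric J) : Prop :=
  ∀ x y z : L, g.dOmega x y z = 0

/-- The metric is pluriclosed if `d(dᶜω) = 0`. -/
def HermMetric.IsPluriclosed (g : HermMetric J) : Prop :=
  ∀ x y z w : L, g.ddcOmega x y z w = 0

/-- The metric is balanced (dimension `2n`): for every orthonormal basis `f`,
`Σ_k dω(f_k, J f_k, x) = 0` for all `x`. -/
def HermMetric.IsBalanced (g : HermMetric J) (n : ℕ) : Prop :=
  ∀ f : Basis (Fin (2 * n)) ℝ L,
    (∀ i j, g.B (f i) (f j) = if i = j then 1 else 0) →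
    ∀ x : L, (∑ k, g.dOmega (f k) (J (f k)) x) = 0

end Defs

section InnerProducts

variable {V : Type*} [AddCommGroup V] [Module ℝ V]

/-- The inner product space structure given by a positive definite symmetric bilinear form. -/
@[reducible]
def coreOfPosDef (B : V →ₗ[ℝ] V →ₗ[ℝ] ℝ) (hs : ∀ x y, B x y = B y x)
    (hp : ∀ x, x ≠ 0 → 0 < B x x) : InnerProductSpace.Core ℝ V where
  inner x y := B x y
  conj_inner_symm x y := by simp [hs x y]
  re_inner_nonneg x := by
    by_cases h : x = 0
    · simp [h]
    · simpa using (hp x h).le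
  add_left x y z := by simp
  smul_left x y r := by simp
  definite x h := by
    by_contra hx
    exact (hp x hx).ne' h

theorem exists_orthonormal_basis_of_posDef [FiniteDimensional ℝ V] (B : V →ₗ[ℝ] V →ₗ[ℝ] ℝ)
    (hs : ∀ x y, B x y = B y x) (hp : ∀ x, x ≠ 0 → 0 < B x x) {m : ℕ} (hm : finrank ℝ V = m) :
    ∃ f : Basis (Fin m) ℝ V, ∀ i j, B (f i) (f j) = if i = j then 1 else 0 := by
  let c := coreOfPosDef B hs hp
  let _ : NormedAddCommGroup V := c.toNormedAddCommGroup
  let _ : InnerProductSpace ℝ V := InnerProductSpace.ofCore c.toCore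
  let e := (stdOrthonormalBasis ℝ V).reindex (finCongr hm)
  refine ⟨e.toBasis, fun i j => ?_⟩
  simp only [OrthonormalBasis.coe_toBasis]
  exact orthonormal_iff_ite.1 e.orthonormal i j

theorem exists_mem_sub_orthogonal_of_posDef [FiniteDimensional ℝ V] (B : V →ₗ[ℝ] V →ₗ[ℝ] ℝ)
    (hs : ∀ x y, B x y = B y x) (hp : ∀ x, x ≠ 0 → 0 < B x x) (W : Submodule ℝ V) (v : V) :
    ∃ w ∈ W, ∀ u ∈ W, B (v - w) u = 0 := by
  let c := coreOfPosDef B hs hp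
  let _ : NormedAddCommGroup V := c.toNormedAddCommGroup
  let _ : InnerProductSpace ℝ V := InnerProductSpace.ofCore c.toCore
  refine ⟨W.starProjection v, W.starProjection_apply_mem v, fun u hu => ?_⟩
  exact (W.mem_orthogonal' _).1 (W.sub_starProjection_mem_orthogonal v) u hu

theorem eq_sum_of_orthonormal {m : ℕ} {B : V →ₗ[ℝ] V →ₗ[ℝ] ℝ} (f : Basis (Fin m) ℝ V)
    (hf : ∀ i j, B (f i) (f j) = if i = j then 1 else 0) (k : Fin m) (v : V) :
    f.repr v k = B (f k) v := by
  conv_rhs => rw [← f.sum_repr v, map_sum]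
  simp only [map_smul, hf]
  simp

theorem trace_eq_sum_of_orthonormal {m : ℕ} {B : V →ₗ[ℝ] V →ₗ[ℝ] ℝ} (f : Basis (Fin m) ℝ V)
    (hf : ∀ i j, B (f i) (f j) = if i = j then 1 else 0) (T : V →ₗ[ℝ] V) :
    LinearMap.trace ℝ V T = ∑ k, B (f k) (T (f k)) := by
  rw [LinearMap.trace_eq_matrix_trace ℝ f, Matrix.trace]
  simp [LinearMap.toMatrix_apply, eq_sum_of_orthonormal f hf]

/-- The trace of a bilinear map vanishing on a subspace `W`, computed in an orthogonal basis `e`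
of a complement. -/
theorem sum_apply_eq_sum_of_orthogonal {M : Type*} [AddCommGroup M] [Module ℝ M] {m r : ℕ}
    {B : V →ₗ[ℝ] V →ₗ[ℝ] ℝ} (hs : ∀ x y, B x y = B y x) (f : Basis (Fin m) ℝ V)
    (hf : ∀ i j, B (f i) (f j) = if i = j then 1 else 0)
    (β : V →ₗ[ℝ] V →ₗ[ℝ] M) (W : Submodule ℝ V) (hβ : ∀ u ∈ W, ∀ v ∈ W, β u v = 0)
    (e : Fin r → V) (N : Fin r → ℝ) (hN : ∀ j, N j ≠ 0)
    (he : ∀ i j, B (e i) (e j) = if i = j then N i else 0)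
    (hW : ∀ v, v - ∑ j, (B (e j) v / N j) • e j ∈ W) :
    ∑ k, β (f k) (f k) = ∑ j, (N j)⁻¹ • β (e j) (e j) := by
  let P : V →ₗ[ℝ] V := LinearMap.id - ∑ j, ((N j)⁻¹ • B (e j)).smulRight (e j)
  have hP : ∀ v, P v = v - ∑ j, (B (e j) v / N j) • e j := by
    intro v
    simp [P, LinearMap.sum_apply, div_eq_inv_mul]
  have hPW : ∀ v, P v ∈ W := fun v => hP v ▸ hW v
  have hPe : ∀ j, P (e j) = 0 := by
    intro j
    simp [hP, he, hN, ite_div]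
  have hsum : ∀ v, ∑ k, B v (f k) • f k = v := by
    intro v
    conv_rhs => rw [← f.sum_repr v]
    simp only [eq_sum_of_orthonormal f hf, hs]
  have hdec : ∀ v, v = P v + ∑ j, (B (e j) v / N j) • e j := fun v => by rw [hP]; simp
  have h1 : ∀ v, β v v = ∑ j, (B (e j) v / N j) • β (e j) (P v)
      + ∑ j, (B (e j) v / N j) • β v (e j) := by
    intro v
    have h2 := congrArg (β v) (hdec v)
    have h3 := congrArg (fun w => β w (P v)) (hdec v)
    simp only [map_add, map_sum, map_smul, LinearMap.add_apply, LinearMap.sum_apply,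
      LinearMap.smul_apply, hβ _ (hPW v) _ (hPW v), zero_add] at h2 h3
    rw [h2, h3]
  have h4 : ∀ (T : V →ₗ[ℝ] M) j, ∑ k, (B (e j) (f k) / N j) • T (f k) = (N j)⁻¹ • T (e j) := by
    intro T j
    conv_rhs => rw [← hsum (e j)]
    simp [Finset.smul_sum, smul_smul, div_eq_inv_mul]
  have h5 : ∀ j, ∑ k, (B (e j) (f k) / N j) • β (e j) (P (f k)) = 0 := by
    intro j
    have := h4 ((β (e j)).comp P) j
    simpa [hPe] using this
  have h6 : ∀ j, ∑ k, (B (e j) (f k) / N j) • β (f k) (e j) = (N j)⁻¹ • β (e j) (e j) :=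
    fun j => h4 (β.flip (e j)) j
  calc ∑ k, β (f k) (f k)
      = ∑ k, ∑ j, (B (e j) (f k) / N j) • β (e j) (P (f k))
        + ∑ k, ∑ j, (B (e j) (f k) / N j) • β (f k) (e j) := by
        rw [← Finset.sum_add_distrib]
        exact Finset.sum_congr rfl fun k _ => h1 (f k)
    _ = ∑ j, (N j)⁻¹ • β (e j) (e j) := by
        rw [Finset.sum_comm, Finset.sum_congr rfl fun j _ => h5 j, Finset.sum_const_zero, zero_add,
          Finset.sum_comm]
        exact Finset.sum_congr rfl fun j _ => h6 j

end InnerProducts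

section Transverse

variable {L : Type*} [LieRing L] [LieAlgebra ℝ L] {J : L →ₗ[ℝ] L}

theorem HermMetric.B_J_left (hJ : IsComplexStructure J) (g : HermMetric J) (x y : L) :
    g.B (J x) y = - g.B x (J y) := by
  rw [← g.compat x (J y), hJ.1]; simp

/-- On a unimodular Lie algebra a balanced metric satisfies `∑ [fₖ, J fₖ] = 0`. -/
theorem HermMetric.IsBalanced.sum_lie_eq_zero (hJ : IsComplexStructure J)
    (huni : IsUnimodularLie L) {g : HermMetric J} {n : ℕ} (hg : g.IsBalanced n)
    (f : Basis (Fin (2 * n)) ℝ L) (hf : ∀ i j, g.B (f i) (f j) = if i = j then 1 else 0) :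
    ∑ k, ⁅f k, J (f k)⁆ = 0 := by
  by_contra hne
  set S := ∑ k, ⁅f k, J (f k)⁆ with hS
  have key : ∀ z, g.B (J S) z = 0 := by
    intro z
    have h1 := trace_eq_sum_of_orthonormal f hf (LieAlgebra.ad ℝ L z)
    have h2 := trace_eq_sum_of_orthonormal f hf (J * (LieAlgebra.ad ℝ L z * J))
    have h3 : J * J = -1 := by ext v; simp [hJ.1]
    rw [huni z] at h1
    rw [LinearMap.trace_mul_comm, mul_assoc, h3, mul_neg, mul_one, map_neg, huni z] at h2
    have h4 := hg f hf z
    have h5 : ∀ k, g.dOmega (f k) (J (f k)) z =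
        - g.B (J ⁅f k, J (f k)⁆) z - g.B (f k) (LieAlgebra.ad ℝ L z (f k))
          + g.B (f k) ((J * (LieAlgebra.ad ℝ L z * J)) (f k)) := by
      intro k
      simp only [HermMetric.dOmega, HermMetric.omega, Module.End.mul_apply, LieAlgebra.ad_apply]
      rw [g.compat, g.symm ⁅f k, z⁆, ← lie_skew (f k) z, ← lie_skew (J (f k)) z, g.symm (J _) (f k)]
      simp only [map_neg]
      ring
    rw [Finset.sum_congr rfl fun k _ => h5 k, Finset.sum_add_distrib, Finset.sum_sub_distrib,
      ← h1, ← h2, Finset.sum_neg_distrib] at h4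
    rw [hS]
    simp only [map_sum, LinearMap.sum_apply]
    linarith
  have := g.posdef S hne
  rw [← g.compat, key] at this
  exact lt_irrefl _ this

/-- An abelian ideal `a` with `a + J a` the whole Lie algebra. -/
structure TransverseIdeal (J : L →ₗ[ℝ] L) (a : Submodule ℝ L) : Prop where
  cs : IsComplexStructure J
  lie_mem : ∀ z : L, ∀ v ∈ a, ⁅z, v⁆ ∈ a
  abel : ∀ u ∈ a, ∀ v ∈ a, ⁅u, v⁆ = 0
  decomp : ∀ z, ∃ u ∈ a, ∃ v ∈ a, z = u + J v

/-- The maximal `J`-invariant subspace of `a`. -/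
def maxInvariant (J : L →ₗ[ℝ] L) (a : Submodule ℝ L) : Submodule ℝ L := a ⊓ a.comap J

/-- A basis `x, y` of a complement of `maxInvariant J a` in `a` with `[Jx, Jy] ≡ σ • Jx`. -/
structure Frame (J : L →ₗ[ℝ] L) (a : Submodule ℝ L) (x y : L) (σ : ℝ) : Prop where
  hx : x ∈ a
  hy : y ∈ a
  span : ∀ v ∈ a, ∃ s t : ℝ, v - (s • x + t • y) ∈ maxInvariant J a
  indep : ∀ s t : ℝ, s • x + t • y ∈ maxInvariant J a → s = 0 ∧ t = 0
  ne : σ ≠ 0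
  lie : ⁅J x, J y⁆ - σ • J x ∈ maxInvariant J a

namespace TransverseIdeal

variable {a : Submodule ℝ L}

theorem J_mem (h : TransverseIdeal J a) {u : L} (hu : u ∈ maxInvariant J a) :
    J u ∈ maxInvariant J a :=
  ⟨hu.2, by simpa [h.cs.1] using hu.1⟩

theorem lie_mem_maxInvariant (h : TransverseIdeal J a) (z : L) {u : L}
    (hu : u ∈ maxInvariant J a) : ⁅z, u⁆ ∈ maxInvariant J a := by
  obtain ⟨v, hv, w, hw, rfl⟩ := h.decomp z
  rw [add_lie, h.abel v hv u hu.1, zero_add]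
  refine ⟨h.lie_mem _ _ hu.1, ?_⟩
  have h1 := h.cs.2 w u
  rw [h.abel w hw u hu.1, h.abel w hw _ hu.2, map_zero, zero_sub, add_zero, neg_add_eq_zero] at h1
  change J _ ∈ a
  rw [← h1]
  exact h.lie_mem _ _ hu.2

theorem lie_mem_maxInvariant' (h : TransverseIdeal J a) (z : L) {u : L}
    (hu : u ∈ maxInvariant J a) : ⁅u, z⁆ ∈ maxInvariant J a := by
  rw [← lie_skew]
  exact neg_mem (h.lie_mem_maxInvariant z hu)

end TransverseIdeal

namespace Frame

variable {a : Submodule ℝ L} {x y : L} {σ : ℝ}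

theorem eq_of_sub_mem (F : Frame J a x y σ) {v : L} {s t s' t' : ℝ}
    (h1 : v - (s • x + t • y) ∈ maxInvariant J a)
    (h2 : v - (s' • x + t' • y) ∈ maxInvariant J a) : s = s' ∧ t = t' := by
  have h3 := sub_mem h2 h1
  have h4 := F.indep (s - s') (t - t') (by convert h3 using 1; module)
  exact ⟨by linarith [h4.1], by linarith [h4.2]⟩

/-- The relations between the structure constants of a frame. -/
theorem exists_coeffs (h : TransverseIdeal J a) (F : Frame J a x y σ) :
    ∃ α β γ p q : ℝ,
      ⁅J x, x⁆ - (α • x + β • y) ∈ maxInvariant J a ∧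
      ⁅J x, y⁆ - (γ • x + (-α) • y) ∈ maxInvariant J a ∧
      ⁅J y, x⁆ - ((γ - σ) • x + (-α) • y) ∈ maxInvariant J a ∧
      ⁅J y, y⁆ - (p • x + q • y) ∈ maxInvariant J a ∧
      α ^ 2 + β * γ = 0 ∧
      σ * β = (γ - σ) * β + 2 * α ^ 2 - β * q ∧
      σ * γ = 2 * p * α + q * γ - γ * (γ - σ) := by
  obtain ⟨α, β, h1⟩ := F.span _ (h.lie_mem (J x) x F.hx)
  obtain ⟨γ, δ, h2⟩ := F.span _ (h.lie_mem (J x) y F.hy)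
  obtain ⟨e, f, h3⟩ := F.span _ (h.lie_mem (J y) x F.hx)
  obtain ⟨p, q, h4⟩ := F.span _ (h.lie_mem (J y) y F.hy)
  have hint : ⁅J x, J y⁆ = J (⁅J x, y⁆ - ⁅J y, x⁆) := by
    have := h.cs.2 x y
    rw [h.abel x F.hx y F.hy, zero_sub, ← lie_skew x (J y)] at this
    rw [map_sub]
    rw [map_neg] at this
    rw [← sub_eq_zero, ← neg_eq_zero, ← this]
    abel
  have h5 : ⁅J x, y⁆ - ⁅J y, x⁆ - (σ • x + (0 : ℝ) • y) ∈ maxInvariant J a := by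
    have h6 := neg_mem (h.J_mem F.lie)
    rw [hint] at h6
    convert h6 using 1
    simp only [map_sub, map_smul, h.cs.1]
    module
  have h7 := F.eq_of_sub_mem h5 (s' := γ - e) (t' := δ - f)
    (by convert sub_mem h2 h3 using 1; module)
  have hmem := fun (u v : L) (hv : v ∈ maxInvariant J a) => h.lie_mem_maxInvariant u hv
  have hbr : ∀ v ∈ a, ⁅J x, ⁅J y, v⁆⁆ - ⁅J y, ⁅J x, v⁆⁆ - σ • ⁅J x, v⁆ ∈ maxInvariant J a := by
    intro v hv
    have h8 := h.lie_mem_maxInvariant' v F.lie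
    rw [sub_lie, smul_lie, lie_lie] at h8
    exact h8
  have hgen : ∀ v ∈ a, ∀ s t m k : ℝ, ⁅J x, v⁆ - (s • x + t • y) ∈ maxInvariant J a →
      ⁅J y, v⁆ - (m • x + k • y) ∈ maxInvariant J a →
      m * α + k * γ - s * e - t * p - σ * s = 0 ∧ m * β + k * δ - s * f - t * q - σ * t = 0 := by
    intro v hv s t m k hA hB
    have k1 := hmem (J x) _ hB
    have k2 := hmem (J y) _ hA
    simp only [lie_sub, lie_add, lie_smul] at k1 k2
    have k3 := add_mem (sub_mem (hbr v hv) k1) k2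
    have k4 := add_mem k3 (Submodule.smul_mem _ σ hA)
    have k5 := sub_mem (sub_mem k4 (Submodule.smul_mem _ m h1)) (Submodule.smul_mem _ k h2)
    have k6 := add_mem (add_mem k5 (Submodule.smul_mem _ s h3)) (Submodule.smul_mem _ t h4)
    apply F.indep
    convert k6 using 1
    module
  obtain ⟨x1, x2⟩ := hgen x F.hx _ _ _ _ h1 h3
  obtain ⟨y1, y2⟩ := hgen y F.hy _ _ _ _ h2 h4
  obtain ⟨rfl⟩ : e = γ - σ := by linarith [h7.1]
  obtain ⟨rfl⟩ : f = δ := by linarith [h7.2]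
  have htr : σ * (α + δ) = 0 := by linarith
  obtain rfl : δ = -α := by linarith [(mul_eq_zero.1 htr).resolve_left F.ne]
  refine ⟨α, β, γ, p, q, h1, h2, h3, h4, ?_, by linarith, by linarith⟩
  have hdet : σ * (α ^ 2 + β * γ) = 0 := by
    linear_combination (-α) * x1 - γ / 2 * x2 - β / 2 * y1
  exact (mul_eq_zero.1 hdet).resolve_left F.ne

theorem congr (h : TransverseIdeal J a) (F : Frame J a x y σ) {x' y' : L} {ν : ℝ}
    (hx : x' - x ∈ maxInvariant J a) (hy : y' - (y + ν • x) ∈ maxInvariant J a) :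
    Frame J a x' y' σ := by
  obtain ⟨u, hu, rfl⟩ : ∃ u ∈ maxInvariant J a, x' = x + u := ⟨_, hx, by abel⟩
  obtain ⟨w, hw, rfl⟩ : ∃ w ∈ maxInvariant J a, y' = y + ν • x + w := ⟨_, hy, by abel⟩
  refine ⟨add_mem F.hx hu.1, add_mem (add_mem F.hy (a.smul_mem _ F.hx)) hw.1, ?_, ?_, F.ne, ?_⟩
  · intro v hv
    obtain ⟨s, t, hst⟩ := F.span v hv
    refine ⟨s - t * ν, t, ?_⟩
    convert sub_mem hst (add_mem (Submodule.smul_mem _ (s - t * ν) hu)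
      (Submodule.smul_mem _ t hw)) using 1
    module
  · intro s t hst
    have := F.indep (s + t * ν) t (by
      convert sub_mem hst (add_mem (Submodule.smul_mem _ s hu) (Submodule.smul_mem _ t hw)) using 1
      module)
    obtain ⟨h1, rfl⟩ := this
    simpa using h1
  · have h1 := h.lie_mem_maxInvariant' (J y + ν • J x + J w) (h.J_mem hu)
    have h2 := h.lie_mem_maxInvariant (J x) (h.J_mem hw)
    have h3 := Submodule.smul_mem _ σ (h.J_mem hu)
    convert add_mem (add_mem F.lie h1) (sub_mem h2 h3) using 1
    simp only [map_add, map_smul, lie_add, add_lie, lie_smul, lie_self]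
    module

theorem exists_orthogonal [FiniteDimensional ℝ L]
    (F : Frame J a x y σ) (g : HermMetric J) :
    ∃ (x' y' : L) (ν : ℝ), x' - x ∈ maxInvariant J a ∧ y' - (y + ν • x) ∈ maxInvariant J a ∧
      (∀ u ∈ maxInvariant J a, g.B x' u = 0) ∧ (∀ u ∈ maxInvariant J a, g.B y' u = 0) ∧
      g.B x' y' = 0 := by
  obtain ⟨u, hu, hu'⟩ := exists_mem_sub_orthogonal_of_posDef g.B g.symm g.posdef
    (maxInvariant J a) x
  obtain ⟨w, hw, hw'⟩ := exists_mem_sub_orthogonal_of_posDef g.B g.symm g.posdef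
    (maxInvariant J a) y
  have hne : x - u ≠ 0 := by
    intro h0
    have := F.indep 1 0 (by rw [sub_eq_zero.1 h0]; simpa using hu)
    exact one_ne_zero this.1
  have hpos := g.posdef _ hne
  set c := g.B (x - u) (y - w) / g.B (x - u) (x - u) with hc
  refine ⟨x - u, y - w - c • (x - u), -c, ?_, ?_, hu', ?_, ?_⟩
  · simpa using hu
  · convert sub_mem (Submodule.smul_mem _ c hu) hw using 1
    module
  · intro v hv
    rw [map_sub, map_smul, LinearMap.sub_apply, LinearMap.smul_apply, hw' v hv, hu' v hv]
    simp
  · rw [map_sub, map_smul, hc, smul_eq_mul, div_mul_cancel₀ _ hpos.ne', sub_self]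

theorem exists_weights_of_isBalanced [FiniteDimensional ℝ L] (h : TransverseIdeal J a)
    (huni : IsUnimodularLie L) {n : ℕ} (hdim : finrank ℝ L = 2 * n) {g : HermMetric J}
    (hg : g.IsBalanced n) (F : Frame J a x y σ)
    (hx : ∀ u ∈ maxInvariant J a, g.B x u = 0) (hy : ∀ u ∈ maxInvariant J a, g.B y u = 0)
    (hxy : g.B x y = 0) :
    ∃ μ ν : ℝ, 0 < μ ∧ 0 < ν ∧ μ • ⁅J x, x⁆ + ν • ⁅J y, y⁆ = 0 := by
  have hJl := g.B_J_left h.cs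
  have hJJ := h.cs.1
  have hJmem : ∀ r : ℝ, r • J x ∈ a → r = 0 := by
    intro r hr
    exact (F.indep r 0 (by
      rw [zero_smul, add_zero]
      exact ⟨a.smul_mem _ F.hx, by simpa using hr⟩)).1
  have hx0 : x ≠ 0 := fun h0 => one_ne_zero (F.indep 1 0 (by simp [h0])).1
  have hX := g.posdef x hx0
  set X := g.B x x with hXdef
  set τ := g.B (J x) y / X with hτ
  have hτX : g.B (J x) y = τ * X := by rw [hτ, div_mul_cancel₀ _ hX.ne']
  set f := y - τ • J x with hf
  have hf0 : f ≠ 0 := by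
    intro h0
    have h1 : y = τ • J x := sub_eq_zero.1 h0
    have h2 := hJmem τ (h1 ▸ F.hy)
    rw [h2, zero_smul] at h1
    exact one_ne_zero (F.indep 0 1 (by simp [h1])).2
  have hY := g.posdef f hf0
  set Y := g.B f f with hYdef
  have hxJx : g.B x (J x) = 0 := by
    have := hJl x x
    rw [g.symm] at this
    linarith
  have hfJf : g.B f (J f) = 0 := by
    have := hJl f f
    rw [g.symm] at this
    linarith
  have hxf : g.B x f = 0 := by rw [hf, map_sub, map_smul, hxy, hxJx]; simp
  have hJxf : g.B (J x) f = 0 := by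
    rw [hf, map_sub, map_smul, hτX, g.compat]; simp [hXdef]
  have hxJf : g.B x (J f) = 0 := by linarith [hJl x f]
  have hJxJf : g.B (J x) (J f) = 0 := by rw [g.compat, hxf]
  have hWJx : ∀ u ∈ maxInvariant J a, g.B (J x) u = 0 := fun u hu => by
    rw [hJl, hx _ (h.J_mem hu), neg_zero]
  have hWf : ∀ u ∈ maxInvariant J a, g.B f u = 0 := fun u hu => by
    rw [hf, map_sub, map_smul, LinearMap.sub_apply, LinearMap.smul_apply, hy u hu, hWJx u hu]
    simp
  have hWJf : ∀ u ∈ maxInvariant J a, g.B (J f) u = 0 := fun u hu => by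
    rw [hJl, hWf _ (h.J_mem hu), neg_zero]
  obtain ⟨E, hE⟩ := exists_orthonormal_basis_of_posDef g.B g.symm g.posdef hdim
  have hsum := hg.sum_lie_eq_zero h.cs huni E hE
  have htr := sum_apply_eq_sum_of_orthogonal g.symm E hE
    ((LieAlgebra.ad ℝ L : L →ₗ[ℝ] L →ₗ[ℝ] L).compl₂ J) (maxInvariant J a)
    (fun u hu v hv => by simpa using h.abel _ hu.1 _ hv.2)
    ![x, J x, f, J f] ![X, X, Y, Y]
    (by intro j; fin_cases j <;> simp [hX.ne', hY.ne'])
    (by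
      have s1 := g.symm (J x) x
      have s2 := g.symm f x
      have s3 := g.symm (J f) x
      have s4 := g.symm f (J x)
      have s5 := g.symm (J f) (J x)
      have s6 := g.symm (J f) f
      clear_value f X Y τ
      intro i j
      fin_cases i <;> fin_cases j <;>
        simp [g.compat, hxJx, hfJf, hxf, hJxf, hxJf, s1, s2, s3, s4, s6,
          ← hXdef, ← hYdef])
    (by
      intro v
      obtain ⟨v₁, hv₁, v₂, hv₂, rfl⟩ := h.decomp v
      obtain ⟨s₁, t₁, h₁⟩ := F.span v₁ hv₁
      obtain ⟨s₂, t₂, h₂⟩ := F.span v₂ hv₂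
      have h₂' := h.J_mem h₂
      obtain ⟨w, hw, hwv⟩ : ∃ w ∈ maxInvariant J a, v₁ + J v₂ =
          w + (s₁ - τ * t₂) • x + (s₂ + t₁ * τ) • J x + t₁ • f + t₂ • J f := by
        refine ⟨_, add_mem h₁ h₂', ?_⟩
        simp only [hf, map_sub, map_add, map_smul, hJJ]
        module
      have s1 := g.symm (J x) x
      have s2 := g.symm f x
      have s3 := g.symm (J f) x
      have s4 := g.symm f (J x)
      have s5 := g.symm (J f) (J x)
      have s6 := g.symm (J f) f
      have e1 : g.B (J x) (J x) = X := g.compat _ _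
      have e2 : g.B (J f) (J f) = Y := g.compat _ _
      rw [hwv]
      clear_value f X Y τ
      simp only [Fin.sum_univ_four, Matrix.cons_val, map_add, map_smul, hx w hw, hWJx w hw,
        hWf w hw, hWJf w hw, s1, s2, s3, s4, s5, s6, e1, e2, ← hXdef, ← hYdef, hxJx, hfJf, hxf,
        hJxf, hxJf, hJxJf, smul_eq_mul, mul_zero, add_zero, zero_add,
        mul_div_cancel_right₀ _ hX.ne', mul_div_cancel_right₀ _ hY.ne']
      convert hw using 1
      module)
  have hsum' : ∑ k, ((LieAlgebra.ad ℝ L : L →ₗ[ℝ] L →ₗ[ℝ] L).compl₂ J) (E k) (E k) = 0 := by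
    simpa using hsum
  have hE0 : X⁻¹ • ⁅x, J x⁆ + Y⁻¹ • ⁅f, J f⁆ = 0 := by
    rw [hsum'] at htr
    simp only [Fin.sum_univ_four, Matrix.cons_val, LinearMap.compl₂_apply, LieHom.coe_toLinearMap,
      LieAlgebra.ad_apply, hJJ, lie_neg] at htr
    rw [← lie_skew (J x) x, ← lie_skew (J f) f] at htr
    have h2 : (2 : ℝ) • (X⁻¹ • ⁅x, J x⁆ + Y⁻¹ • ⁅f, J f⁆) = 0 := by
      rw [htr]
      module
    exact (smul_eq_zero.1 h2).resolve_left two_ne_zero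
  have hff : ⁅f, J f⁆ = ⁅y, J y⁆ - τ • ⁅J x, J y⁆ - (τ ^ 2) • ⁅J x, x⁆ := by
    simp only [hf, map_sub, map_smul, hJJ, sub_lie, smul_lie, lie_sub, lie_smul, lie_neg,
      h.abel y F.hy x F.hx]
    module
  have hτ0 : τ = 0 := by
    have h1 : (Y⁻¹ * τ * σ) • J x ∈ a := by
      have h2 : X⁻¹ • ⁅x, J x⁆ + Y⁻¹ • (⁅y, J y⁆ - (τ ^ 2) • ⁅J x, x⁆) ∈ a := by
        rw [← lie_skew x, ← lie_skew y]
        have hAx := h.lie_mem (J x) x F.hx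
        have hBy := h.lie_mem (J y) y F.hy
        exact add_mem (a.smul_mem _ (neg_mem hAx))
          (a.smul_mem _ (sub_mem (neg_mem hBy) (a.smul_mem _ hAx)))
      have h3 := a.smul_mem (Y⁻¹ * τ) F.lie.1
      rw [hff] at hE0
      convert sub_mem (sub_mem h2 h3) (hE0 ▸ a.zero_mem) using 1
      module
    have h4 := hJmem _ h1
    simpa [hY.ne', F.ne] using h4
  refine ⟨X⁻¹, Y⁻¹, inv_pos.2 hX, inv_pos.2 hY, ?_⟩
  rw [hff, hτ0, ← lie_skew x, ← lie_skew y] at hE0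
  rw [← neg_eq_zero, ← hE0]
  module

end Frame

namespace TransverseIdeal

variable {a : Submodule ℝ L}

theorem lie_J_J (h : TransverseIdeal J a) {u v : L} (hu : u ∈ a) (hv : v ∈ a) :
    ∃ w ∈ a, ⁅J u, J v⁆ = J w := by
  refine ⟨⁅J u, v⁆ - ⁅J v, u⁆, sub_mem (h.lie_mem _ _ hv) (h.lie_mem _ _ hu), ?_⟩
  have := h.cs.2 u v
  rw [h.abel u hu v hv, zero_sub, ← lie_skew u (J v), map_neg] at this
  rw [map_sub, ← sub_eq_zero, ← neg_eq_zero, ← this]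
  abel

/-- Modulo `a`, every bracket is a multiple of `[Jx, Jy]`. -/
theorem exists_lie_sub_smul_mem (h : TransverseIdeal J a) {x y : L}
    (hspan : ∀ v ∈ a, ∃ s t : ℝ, v - (s • x + t • y) ∈ maxInvariant J a) (u v : L) :
    ∃ r : ℝ, ⁅u, v⁆ - r • ⁅J x, J y⁆ ∈ a := by
  have main : ∀ z : L, ∃ s t : ℝ, z - (s • J x + t • J y) ∈ a := by
    intro z
    obtain ⟨z₁, h₁, z₂, h₂, rfl⟩ := h.decomp z
    obtain ⟨s, t, hst⟩ := hspan z₂ h₂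
    refine ⟨s, t, ?_⟩
    convert add_mem h₁ (h.J_mem hst).1 using 1
    simp only [map_sub, map_add, map_smul]
    module
  obtain ⟨s, t, hu⟩ := main u
  obtain ⟨m, k, hv⟩ := main v
  refine ⟨s * k - t * m, ?_⟩
  have h1 := h.lie_mem u _ hv
  have h2 := h.lie_mem (m • J x + k • J y) _ hu
  convert sub_mem h1 h2 using 1
  simp only [lie_sub, lie_add, lie_smul, add_lie, smul_lie, lie_self]
  rw [← lie_skew (J y) (J x), ← lie_skew u (J x), ← lie_skew u (J y)]
  module

theorem exists_frame [FiniteDimensional ℝ L] (h : TransverseIdeal J a)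
    (hrank : finrank ℝ (maxInvariant J a) + 2 = finrank ℝ a)
    (hnonab : ¬ ∀ u v : L, ⁅u, v⁆ ∈ a) :
    ∃ (x y : L) (σ : ℝ), Frame J a x y σ := by
  have hJJ := h.cs.1
  push Not at hnonab
  obtain ⟨u, v, huv⟩ := hnonab
  obtain ⟨u₁, hu₁, u₂, hu₂, rfl⟩ := h.decomp u
  obtain ⟨v₁, hv₁, v₂, hv₂, rfl⟩ := h.decomp v
  obtain ⟨x, hx, hxe⟩ := h.lie_J_J hu₂ hv₂
  have hJx : J x ∉ a := by
    intro hJx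
    apply huv
    rw [add_lie, lie_add (J u₂), hxe, ← lie_skew u₁]
    exact add_mem (neg_mem (h.lie_mem _ _ hu₁)) (add_mem (h.lie_mem _ _ hv₁) hJx)
  set W := maxInvariant J a
  have hxW : x ∉ W := fun hx' => hJx hx'.2
  have hx0 : x ≠ 0 := fun h0 => hxW (h0 ▸ W.zero_mem)
  have hWa : W ≤ a := inf_le_left
  have hspanx : Submodule.span ℝ {x} ≤ a := by simpa using hx
  have hlt : W < W ⊔ Submodule.span ℝ {x} := by simpa using hxW
  have hle : W ⊔ Submodule.span ℝ {x} ≤ a := sup_le hWa hspanx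
  have hr1 := Submodule.finrank_lt_finrank_of_lt hlt
  have hr2 : finrank ℝ ↥(W ⊔ Submodule.span ℝ {x}) ≤ finrank ℝ W + 1 :=
    (Submodule.finrank_add_le_finrank_add_finrank _ _).trans
      (Nat.add_le_add_left (finrank_span_singleton hx0).le _)
  obtain ⟨y, hy, hyW⟩ : ∃ y ∈ a, y ∉ W ⊔ Submodule.span ℝ {x} := by
    by_contra! hcon
    have := Submodule.finrank_mono (show a ≤ _ from hcon)
    omega
  have hlt' : W ⊔ Submodule.span ℝ {x} < W ⊔ Submodule.span ℝ {x} ⊔ Submodule.span ℝ {y} := by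
    simpa using hyW
  have hle' : W ⊔ Submodule.span ℝ {x} ⊔ Submodule.span ℝ {y} ≤ a :=
    sup_le hle (by simpa using hy)
  have heq := Submodule.eq_of_le_of_finrank_le hle' (by
    have := Submodule.finrank_lt_finrank_of_lt hlt'
    omega)
  have hspan : ∀ v ∈ a, ∃ s t : ℝ, v - (s • x + t • y) ∈ W := by
    intro v hv
    rw [← heq, Submodule.mem_sup] at hv
    obtain ⟨w, hw, z, hz, rfl⟩ := hv
    obtain ⟨w, hw', z', hz', rfl⟩ := Submodule.mem_sup.1 hw
    obtain ⟨s, rfl⟩ := Submodule.mem_span_singleton.1 hz'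
    obtain ⟨t, rfl⟩ := Submodule.mem_span_singleton.1 hz
    exact ⟨s, t, by convert hw' using 1; abel⟩
  have hindep : ∀ s t : ℝ, s • x + t • y ∈ W → s = 0 ∧ t = 0 := by
    intro s t hst
    have ht : t = 0 := by
      by_contra ht
      apply hyW
      rw [← inv_smul_smul₀ ht y]
      apply Submodule.smul_mem
      have : t • y = (s • x + t • y) + (-s) • x := by module
      rw [this]
      exact add_mem (Submodule.mem_sup_left hst)
        (Submodule.mem_sup_right (Submodule.smul_mem _ _ (Submodule.mem_span_singleton_self x)))
    subst ht
    refine ⟨?_, rfl⟩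
    by_contra hs
    apply hxW
    rw [← inv_smul_smul₀ hs x]
    exact Submodule.smul_mem _ _ (by simpa using hst)
  obtain ⟨w, hw, hwe⟩ := h.lie_J_J hx hy
  obtain ⟨s, t, hst⟩ := hspan w hw
  obtain ⟨r, hr⟩ := h.exists_lie_sub_smul_mem hspan (J u₂) (J v₂)
  have h1 : (1 - r * s) • x + (-(r * t)) • y ∈ W := by
    refine ⟨add_mem (a.smul_mem _ hx) (a.smul_mem _ hy), ?_⟩
    change J _ ∈ a
    rw [hxe, hwe] at hr
    convert add_mem hr (a.smul_mem r (h.J_mem hst).1) using 1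
    simp only [map_sub, map_add, map_smul]
    module
  obtain ⟨h2, h3⟩ := hindep _ _ h1
  have hs : s ≠ 0 := by
    rintro rfl
    simp at h2
  have hr0 : r ≠ 0 := by
    rintro rfl
    simp at h2
  have ht : t = 0 := by simpa [hr0] using h3
  refine ⟨x, y, s, hx, hy, hspan, hindep, hs, ?_⟩
  rw [hwe]
  convert h.J_mem hst using 1
  simp [ht]

end TransverseIdeal

/-- In a balanced metric, either the constant `β` of a suitable frame vanishes and the ideal acts
in degenerate form, or `σ * β > 0`. -/
theorem Frame.exists_balanced_frame [FiniteDimensional ℝ L] {a : Submodule ℝ L} {x y : L} {σ : ℝ}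
    (h : TransverseIdeal J a) (huni : IsUnimodularLie L) {n : ℕ} (hdim : finrank ℝ L = 2 * n)
    {g : HermMetric J} (hg : g.IsBalanced n) (F : Frame J a x y σ) :
    ∃ (x' y' : L) (ν : ℝ), x' - x ∈ maxInvariant J a ∧ y' - (y + ν • x) ∈ maxInvariant J a ∧
      Frame J a x' y' σ ∧ ∃ α β : ℝ,
        ⁅J x', x'⁆ - (α • x' + β • y') ∈ maxInvariant J a ∧ (β ≠ 0 → 0 < σ * β) ∧
        (β = 0 → ⁅J x', x'⁆ ∈ maxInvariant J a ∧ ⁅J x', y'⁆ ∈ maxInvariant J a ∧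
          ⁅J y', x'⁆ - (-σ) • x' ∈ maxInvariant J a ∧ ⁅J y', y'⁆ ∈ maxInvariant J a) := by
  obtain ⟨x', y', c, hx', hy', ox, oy, oxy⟩ := F.exists_orthogonal g
  have F' := F.congr h hx' hy'
  obtain ⟨μ, ν, hμ, hν, hbal⟩ := F'.exists_weights_of_isBalanced h huni hdim hg ox oy oxy
  obtain ⟨α, β, γ, p, q, h1, h2, h3, h4, e1, e2, e3⟩ := F'.exists_coeffs h
  refine ⟨x', y', c, hx', hy', F', α, β, h1, ?_⟩
  obtain ⟨b1, b2⟩ := F'.indep (μ * α + ν * p) (μ * β + ν * q) (by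
    have := neg_mem (add_mem (Submodule.smul_mem _ μ h1) (Submodule.smul_mem _ ν h4))
    convert this using 1
    rw [← sub_eq_zero, ← hbal]
    module)
  constructor
  · intro hβ
    have hpos : 0 < ν * α ^ 2 + μ * β ^ 2 := by positivity
    have : 2 * ν * (σ * β) = ν * α ^ 2 + μ * β ^ 2 := by
      linear_combination ν * e2 + ν * e1 - β * b2
    exact pos_of_mul_pos_right (this ▸ hpos) (by positivity)
  · rintro rfl
    obtain rfl : α = 0 := by simpa using e1
    obtain rfl : p = 0 := by simpa [hν.ne'] using b1
    obtain rfl : q = 0 := by simpa [hν.ne'] using b2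
    obtain rfl : γ = 0 := by
      have : γ ^ 2 = 0 := by linarith
      simpa using this
    refine ⟨by simpa using h1, by simpa using h2, by simpa using h3, by simpa using h4⟩

theorem even_finrank_of_invariant {V : Type*} [AddCommGroup V] [Module ℝ V]
    [FiniteDimensional ℝ V] {T : V →ₗ[ℝ] V} (hT : ∀ x, T (T x) = -x) (W : Submodule ℝ V)
    (hW : ∀ u ∈ W, T u ∈ W) : Even (finrank ℝ W) := by
  have h1 : T.restrict hW * T.restrict hW = (-1 : ℝ) • (1 : Module.End ℝ W) := by
    ext u
    simp [hT]
  have h2 := congrArg LinearMap.det h1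
  rw [map_mul, LinearMap.det_smul, map_one, mul_one] at h2
  by_contra hodd
  rw [Nat.not_even_iff_odd] at hodd
  rw [hodd.neg_one_pow] at h2
  nlinarith [mul_self_nonneg (LinearMap.det (T.restrict hW))]

theorem maxInvariant_eq (hJJ : ∀ x, J (J x) = -x) (a : Submodule ℝ L) :
    maxInvariant J a = a ⊓ a.map J := by
  ext u
  constructor
  · rintro ⟨h1, h2⟩
    exact ⟨h1, -J u, neg_mem h2, by simp [hJJ]⟩
  · rintro ⟨h1, v, hv, rfl⟩
    refine ⟨h1, ?_⟩
    change J _ ∈ a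
    rw [hJJ]
    exact neg_mem hv

theorem finrank_maxInvariant [FiniteDimensional ℝ L] (hJJ : ∀ x, J (J x) = -x)
    {a : Submodule ℝ L} (hcodim : finrank ℝ a + 2 = finrank ℝ L) (hJa : a.map J ≠ a) :
    finrank ℝ (maxInvariant J a) + 2 = finrank ℝ a ∧ a ⊔ a.map J = ⊤ := by
  have hinj : Function.Injective J := by
    intro u v huv
    have := congrArg J huv
    simpa [hJJ] using this
  have hmap : finrank ℝ (a.map J) = finrank ℝ a :=
    (Submodule.equivMapOfInjective J hinj a).finrank_eq.symm
  have hsum := Submodule.finrank_sup_add_finrank_inf_eq a (a.map J)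
  rw [← maxInvariant_eq hJJ, hmap] at hsum
  have hlt : finrank ℝ (maxInvariant J a) < finrank ℝ a := by
    apply Submodule.finrank_lt_finrank_of_lt
    refine lt_of_le_of_ne inf_le_left fun heq => hJa ?_
    rw [maxInvariant_eq hJJ, inf_eq_left] at heq
    exact (Submodule.eq_of_le_of_finrank_eq heq hmap.symm).symm
  have hle := Submodule.finrank_le (a ⊔ a.map J)
  obtain ⟨i, hi⟩ := even_finrank_of_invariant hJJ (maxInvariant J a)
    (fun u hu => ⟨hu.2, by simpa [hJJ] using hu.1⟩)
  obtain ⟨j, hj⟩ := even_finrank_of_invariant hJJ (⊤ : Submodule ℝ L) (fun u hu => trivial)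
  rw [finrank_top] at hj
  exact ⟨by omega, Submodule.eq_top_of_finrank_eq (by omega)⟩

/-- The subspace `a ∩ J (a + [g, g])` is spanned by `x` modulo `maxInvariant J a`. -/
theorem Frame.mem_inf_map_iff {a : Submodule ℝ L} {x y : L} {σ : ℝ} (h : TransverseIdeal J a)
    (F : Frame J a x y σ) (u : L) :
    u ∈ a ⊓ (a ⊔ Submodule.span ℝ {z : L | ∃ u v : L, ⁅u, v⁆ = z}).map J ↔
      ∃ s : ℝ, u - s • x ∈ maxInvariant J a := by
  have hJJ := h.cs.1
  have hle : a ⊔ Submodule.span ℝ {z : L | ∃ u v : L, ⁅u, v⁆ = z} ≤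
      a ⊔ Submodule.span ℝ {J x} := by
    refine sup_le le_sup_left (Submodule.span_le.2 ?_)
    rintro _ ⟨v, w, rfl⟩
    obtain ⟨r, hr⟩ := h.exists_lie_sub_smul_mem F.span v w
    have : ⁅v, w⁆ = (⁅v, w⁆ - r • ⁅J x, J y⁆ + r • (⁅J x, J y⁆ - σ • J x)) + (r * σ) • J x := by
      module
    rw [SetLike.mem_coe, this]
    exact add_mem (Submodule.mem_sup_left (add_mem hr (a.smul_mem r F.lie.1)))
      (Submodule.mem_sup_right (Submodule.smul_mem _ _ (Submodule.mem_span_singleton_self _)))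
  constructor
  · rintro ⟨hu, w, hw, rfl⟩
    obtain ⟨v, hv, z, hz, rfl⟩ := Submodule.mem_sup.1 (hle hw)
    obtain ⟨r, rfl⟩ := Submodule.mem_span_singleton.1 hz
    refine ⟨-r, ?_⟩
    have heq : J (v + r • J x) - (-r) • x = J v := by
      simp only [map_add, map_smul, hJJ]
      module
    rw [heq]
    refine ⟨?_, ?_⟩
    · rw [← heq]
      exact sub_mem hu (a.smul_mem _ F.hx)
    · change J _ ∈ a
      rw [hJJ]
      exact neg_mem hv
  · rintro ⟨s, hs⟩
    refine ⟨?_, -J u, ?_, by simp [hJJ]⟩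
    · simpa using add_mem hs.1 (a.smul_mem s F.hx)
    · have : -J u = -(J (u - s • x)) + (s * σ⁻¹) • (⁅J x, J y⁆ - σ • J x)
          + (-(s * σ⁻¹)) • ⁅J x, J y⁆ := by
        simp only [map_sub, map_smul, smul_sub, smul_smul]
        rw [mul_assoc, inv_mul_cancel₀ F.ne]
        module
      rw [this]
      exact add_mem (Submodule.mem_sup_left
        (add_mem (neg_mem (h.J_mem hs).1) (a.smul_mem _ F.lie.1)))
        (Submodule.mem_sup_right (Submodule.smul_mem _ _ (Submodule.subset_span ⟨_, _, rfl⟩)))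

/-- The constants `σ` and `β` of any frame have the same sign in the presence of a balanced
metric, unless `β = 0`. -/
theorem Frame.mul_pos_of_isBalanced [FiniteDimensional ℝ L] {a : Submodule ℝ L} {x y : L}
    {σ : ℝ} (h : TransverseIdeal J a) (huni : IsUnimodularLie L) {n : ℕ}
    (hdim : finrank ℝ L = 2 * n) {g : HermMetric J} (hg : g.IsBalanced n) (F : Frame J a x y σ)
    {α β : ℝ} (hβ : ⁅J x, x⁆ - (α • x + β • y) ∈ maxInvariant J a) (hβ0 : β ≠ 0) :
    0 < σ * β := by
  obtain ⟨x', y', ν, hx, hy, F', α', β', h1, h2, -⟩ := F.exists_balanced_frame h huni hdim hg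
  obtain ⟨u, hu, rfl⟩ : ∃ u ∈ maxInvariant J a, x' = x + u := ⟨_, hx, by abel⟩
  obtain ⟨w, hw, rfl⟩ : ∃ w ∈ maxInvariant J a, y' = y + ν • x + w := ⟨_, hy, by abel⟩
  have h3 : ⁅J x, x⁆ - ((α' + β' * ν) • x + β' • y) ∈ maxInvariant J a := by
    have k1 := h.lie_mem_maxInvariant (J (x + u)) hu
    have k2 := h.lie_mem_maxInvariant' x (h.J_mem hu)
    have k3 := add_mem (Submodule.smul_mem _ α' hu) (Submodule.smul_mem _ β' hw)
    convert add_mem (sub_mem (sub_mem h1 k1) k2) k3 using 1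
    simp only [map_add, lie_add, add_lie]
    module
  obtain ⟨-, rfl⟩ := F.eq_of_sub_mem hβ h3
  exact h2 hβ0

end Transverse

theorem stmt10
    {L : Type*} [LieRing L] [LieAlgebra ℝ L] [FiniteDimensional ℝ L]
    (a : LieIdeal ℝ L)
    (habel : ∀ u ∈ a.toSubmodule, ∀ v ∈ a.toSubmodule, ⁅u, v⁆ = (0 : L))
    (hcodim : finrank ℝ ↥a.toSubmodule + 2 = finrank ℝ L)
    (J : L →ₗ[ℝ] L) (hJ : IsComplexStructure J)
    (huni : IsUnimodularLie L)
    (n : ℕ) (hdim : finrank ℝ L = 2 * n)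
    (hJa : a.toSubmodule.map J ≠ a.toSubmodule)
    (hnonab : ¬ ∀ u v : L, ⁅u, v⁆ ∈ a.toSubmodule)
    (aJ a' bb : Submodule ℝ L)
    (haJ : aJ = a.toSubmodule ⊓ a.toSubmodule.map J)
    (ha' : a' = a.toSubmodule ⊔ Submodule.span ℝ {z : L | ∃ u v : L, ⁅u, v⁆ = z})
    (hbb : bb = a.toSubmodule ⊓ a'.map J)
    (hbal : ∃ g : HermMetric J, g.IsBalanced n) :
    (((∀ u ∈ bb, ∀ v ∈ a.toSubmodule, ⁅J u, v⁆ ∈ aJ) ∧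
      (∀ z : L, ∀ v ∈ a.toSubmodule, ⁅z, v⁆ ∈ bb)) ∨
     ((¬ ∀ u ∈ bb, ∀ v ∈ bb, ⁅J u, v⁆ ∈ bb) ∧
      (∀ x y : L, x ∈ bb → x ∉ aJ → y ∈ a.toSubmodule →
        a.toSubmodule = aJ ⊔ Submodule.span ℝ {x} ⊔ Submodule.span ℝ {y} →
        (∀ (s t : ℝ) (u : L), u ∈ aJ → s • x + t • y + u = 0 → s = 0 ∧ t = 0) →
        ∀ σ a₀ b₀ : ℝ,
          ⁅J x, J y⁆ - σ • J x ∈ aJ →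
          ⁅J x, x⁆ - (a₀ • x + b₀ • y) ∈ aJ →
          σ * b₀ > 0))) ∧
    ¬ ((∀ u ∈ bb, ∀ v ∈ bb, ⁅J u, v⁆ ∈ bb) ∧
       ¬ (∀ u ∈ bb, ∀ v ∈ a.toSubmodule, ⁅J u, v⁆ ∈ aJ)) := by
  have hJJ := hJ.1
  set A : Submodule ℝ L := a.toSubmodule
  obtain ⟨hrank, htop⟩ := finrank_maxInvariant hJJ hcodim hJa
  rw [← maxInvariant_eq hJJ] at haJ
  subst haJ ha' hbb
  have h : TransverseIdeal J A := by
    refine ⟨hJ, fun z v hv => lie_mem_right ℝ L a z v hv, habel, fun z => ?_⟩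
    obtain ⟨u, hu, _, ⟨v, hv, rfl⟩, rfl⟩ := Submodule.mem_sup.1 (htop ▸ Submodule.mem_top (x := z))
    exact ⟨u, hu, v, hv, rfl⟩
  obtain ⟨g, hg⟩ := hbal
  obtain ⟨x₀, y₀, σ, F₀⟩ := h.exists_frame hrank hnonab
  obtain ⟨x, y, -, -, -, F, α, β, h1, hpos, hzero⟩ := F₀.exists_balanced_frame h huni hdim hg
  have hmem := F.mem_inf_map_iff h
  simp only [hmem]
  set W := maxInvariant J A
  refine (fun key => ⟨key, fun hq => key.elim (fun k => hq.2 k.1) (fun k => k.1 hq.1)⟩) ?_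
  by_cases hβ : β = 0
  · left
    obtain ⟨hxx, hxy, hyx, hyy⟩ := hzero hβ
    have hJx : ∀ v ∈ A, ⁅J x, v⁆ ∈ W := by
      intro v hv
      obtain ⟨s, t, hst⟩ := F.span v hv
      convert add_mem (h.lie_mem_maxInvariant (J x) hst)
        (add_mem (W.smul_mem s hxx) (W.smul_mem t hxy)) using 1
      simp only [lie_sub, lie_add, lie_smul]
      module
    have hJy : ∀ v ∈ A, ∃ s : ℝ, ⁅J y, v⁆ - s • x ∈ W := by
      intro v hv
      obtain ⟨s, t, hst⟩ := F.span v hv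
      refine ⟨s * -σ, ?_⟩
      convert add_mem (h.lie_mem_maxInvariant (J y) hst)
        (add_mem (W.smul_mem s hyx) (W.smul_mem t hyy)) using 1
      simp only [lie_sub, lie_add, lie_smul]
      module
    constructor
    · rintro u ⟨s, hs⟩ v hv
      convert add_mem (h.lie_mem_maxInvariant' v (h.J_mem hs)) (W.smul_mem s (hJx v hv)) using 1
      simp only [map_sub, map_smul, sub_lie, smul_lie]
      module
    · intro z v hv
      obtain ⟨u, hu, w, hw, rfl⟩ := h.decomp z
      obtain ⟨s, t, hst⟩ := F.span w hw
      obtain ⟨r, hr⟩ := hJy v hv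
      refine ⟨t * r, ?_⟩
      convert add_mem (h.lie_mem_maxInvariant' v (h.J_mem hst))
        (add_mem (W.smul_mem s (hJx v hv)) (W.smul_mem t hr)) using 1
      simp only [map_sub, map_add, map_smul, sub_lie, add_lie, smul_lie, h.abel u hu v hv]
      module
  · right
    constructor
    · intro hall
      have hx : ∃ s : ℝ, x - s • x ∈ W := ⟨1, by simp⟩
      obtain ⟨s, hs⟩ := hall x hx x hx
      exact hβ (F.eq_of_sub_mem h1 (s' := s) (t' := 0) (by simpa using hs)).2
    · intro x' y' hx' hx'W hy' hspan hindep σ' α' β' hσ' hβ'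
      have hx'A : x' ∈ A := by
        rw [hspan]
        exact Submodule.mem_sup_left
          (Submodule.mem_sup_right (Submodule.mem_span_singleton_self _))
      have hspan' : ∀ v ∈ A, ∃ s t : ℝ, v - (s • x' + t • y') ∈ W := by
        intro v hv
        rw [hspan] at hv
        obtain ⟨w, hw, _, hz, rfl⟩ := Submodule.mem_sup.1 hv
        obtain ⟨w, hw', _, hz', rfl⟩ := Submodule.mem_sup.1 hw
        obtain ⟨s, rfl⟩ := Submodule.mem_span_singleton.1 hz'
        obtain ⟨t, rfl⟩ := Submodule.mem_span_singleton.1 hz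
        exact ⟨s, t, by convert hw' using 1; abel⟩
      have hne : σ' ≠ 0 := by
        rintro rfl
        apply hnonab
        intro u v
        obtain ⟨r, hr⟩ := h.exists_lie_sub_smul_mem hspan' u v
        have := hσ'.1
        rw [zero_smul, sub_zero] at this
        simpa using add_mem hr (A.smul_mem r this)
      have F' : Frame J A x' y' σ' :=
        ⟨hx'A, hy', hspan', fun s t hst => hindep s t _ (neg_mem hst) (by abel), hne, hσ'⟩
      refine F'.mul_pos_of_isBalanced h huni hdim hg hβ' ?_
      rintro rfl
      obtain ⟨s, hs⟩ := hx'
      obtain ⟨u, hu, rfl⟩ : ∃ u ∈ W, x' = s • x + u := ⟨_, hs, by abel⟩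
      have h2 : s ^ 2 • ⁅J x, x⁆ - ((α' * s) • x + (0 : ℝ) • y) ∈ W := by
        have k1 := h.lie_mem_maxInvariant (J (s • x + u)) hu
        have k2 := h.lie_mem_maxInvariant' x (h.J_mem hu)
        convert add_mem (sub_mem (sub_mem hβ' k1) (W.smul_mem s k2)) (W.smul_mem α' hu) using 1
        simp only [map_add, map_smul, lie_add, add_lie, lie_smul, smul_lie]
        module
      have h3 : s ^ 2 • ⁅J x, x⁆ - ((s ^ 2 * α) • x + (s ^ 2 * β) • y) ∈ W := by
        convert W.smul_mem (s ^ 2) h1 using 1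
        module
      have h4 := (F.eq_of_sub_mem h2 h3).2
      have hs0 : s ≠ 0 := by
        rintro rfl
        exact hx'W (by simpa using hu)
      exact mul_ne_zero (pow_ne_zero 2 hs0) hβ h4.symm
end

section
/- Let g be a finite-dimensional unimodular real Lie algebra of dimension 2n containing an abelian ideal a of codimension 2, and J a complex structure on g with J(a) ≠ a and [g,g] ⊄ a. Assume J is degenerate, i.e. [J𝔟,a] ⊆ a_J. If (g,J) admits a pluriclosed Hermitian metric, then [g,a] ⊄ 𝔟 (equivalently, for every choice of x ∈ 𝔟 \ a_J and y ∈ a with a = a_J ⊕ ℝx ⊕ ℝy, the constant d' determined by [Jy,y] − (c'x + d'y) ∈ a_J is nonzero). In particular, (g,J) admits no balanced Hermitian metric. -/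
open Module

section OrthonormalBases

variable {V : Type*} [AddCommGroup V] [Module ℝ V]

section

variable {ι : Type*} [Fintype ι] [DecidableEq ι] {B : V →ₗ[ℝ] V →ₗ[ℝ] ℝ} {e : Basis ι ℝ V}

theorem bilin_basis_eq_repr (he : ∀ i j, B (e i) (e j) = if i = j then 1 else 0)
    (v : V) (i : ι) : B (e i) v = e.repr v i := by
  conv_lhs => rw [← e.sum_repr v]
  simp [he, -Basis.sum_repr]

theorem trace_eq_sum_bilin (he : ∀ i j, B (e i) (e j) = if i = j then 1 else 0)
    (T : V →ₗ[ℝ] V) : LinearMap.trace ℝ V T = ∑ i, B (e i) (T (e i)) := by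
  rw [LinearMap.trace_eq_matrix_trace ℝ e, Matrix.trace]
  refine Finset.sum_congr rfl fun i _ => ?_
  rw [Matrix.diag_apply, LinearMap.toMatrix_apply, bilin_basis_eq_repr he]

end

variable [FiniteDimensional ℝ V]

/-- A positive definite symmetric bilinear form admits an orthonormal basis. -/
theorem exists_orthonormal_basis_of_posdef (B : V →ₗ[ℝ] V →ₗ[ℝ] ℝ)
    (symm : ∀ u v, B u v = B v u) (posdef : ∀ u, u ≠ 0 → 0 < B u u) :
    ∃ e : Basis (Fin (finrank ℝ V)) ℝ V, ∀ i j, B (e i) (e j) = if i = j then 1 else 0 := by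
  let core : InnerProductSpace.Core ℝ V :=
    { inner := fun u v => B u v
      conj_inner_symm := fun u v => by simpa using symm v u
      re_inner_nonneg := fun u => by
        rcases eq_or_ne u 0 with rfl | hu
        · simp
        · simpa using (posdef u hu).le
      add_left := fun u v w => by simp
      smul_left := fun u v r => by simp
      definite := fun u hu => by
        by_contra h
        exact (posdef u h).ne' hu }
  let _ : NormedAddCommGroup V := core.toNormedAddCommGroup
  let _ : InnerProductSpace ℝ V := InnerProductSpace.ofCore core.toCore
  refine ⟨(stdOrthonormalBasis ℝ V).toBasis, fun i j => ?_⟩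
  rw [OrthonormalBasis.coe_toBasis]
  exact orthonormal_iff_ite.mp (stdOrthonormalBasis ℝ V).orthonormal i j

/-- An endomorphism with `|Du|² + ⟨D²u, u⟩ = 0` for all `u` is skew-symmetric. -/
theorem skew_of_normSq_add_sq_eq_zero (B : V →ₗ[ℝ] V →ₗ[ℝ] ℝ)
    (symm : ∀ u v, B u v = B v u) (posdef : ∀ u, u ≠ 0 → 0 < B u u) (D : V →ₗ[ℝ] V)
    (hD : ∀ u, B (D u) (D u) + B (D (D u)) u = 0) (u v : V) : B (D u) v = - B (D v) u := by
  obtain ⟨e, he⟩ := exists_orthonormal_basis_of_posdef B symm posdef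
  set m : Fin (finrank ℝ V) → Fin (finrank ℝ V) → ℝ := fun i j => B (e i) (D (e j)) with hm
  have hDe : ∀ j, D (e j) = ∑ i, m i j • e i := fun j => by
    conv_lhs => rw [← e.sum_repr (D (e j))]
    simp [hm, bilin_basis_eq_repr he]
  have h1 : ∀ j, ∑ i, (m i j * m i j + m i j * m j i) = 0 := fun j => by
    have h := hD (e j)
    have ha : B (D (e j)) (D (e j)) = ∑ i, m i j * m i j := by
      conv_lhs => enter [1]; rw [hDe j]
      simp only [map_sum, map_smul, LinearMap.sum_apply, LinearMap.smul_apply, smul_eq_mul, hm]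
    have hb : B (D (D (e j))) (e j) = ∑ i, m i j * m j i := by
      rw [hDe j]
      simp only [map_sum, map_smul, LinearMap.sum_apply, LinearMap.smul_apply, smul_eq_mul]
      exact Finset.sum_congr rfl fun i _ => by rw [symm]
    rw [ha, hb] at h
    rw [Finset.sum_add_distrib, h]
  have h2 : ∑ j, ∑ i, (m i j + m j i) ^ 2 = 0 := by
    have h3 : ∑ j, ∑ i, (m i j * m i j + m i j * m j i) = 0 := by simp [h1]
    have h4 : ∑ j, ∑ i, (m j i * m j i + m j i * m i j) = 0 := by
      rw [Finset.sum_comm]; exact h3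
    have h5 := congrArg₂ (· + ·) h3 h4
    simp only [← Finset.sum_add_distrib, add_zero] at h5
    rw [← h5]
    exact Finset.sum_congr rfl fun j _ => Finset.sum_congr rfl fun i _ => by ring
  have h5 : ∀ i j, m i j + m j i = 0 := fun i j => by
    have h6 := (Finset.sum_eq_zero_iff_of_nonneg
      (fun j _ => Finset.sum_nonneg fun i _ => sq_nonneg _)).mp h2 j (Finset.mem_univ _)
    have h7 := (Finset.sum_eq_zero_iff_of_nonneg
      (fun i _ => sq_nonneg _)).mp h6 i (Finset.mem_univ _)
    exact pow_eq_zero_iff two_ne_zero |>.mp h7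
  have h8 : B ∘ₗ D = - (B ∘ₗ D).flip := by
    refine e.ext fun i => e.ext fun j => ?_
    have := h5 i j
    simp only [hm] at this
    simp only [LinearMap.comp_apply, LinearMap.neg_apply, LinearMap.flip_apply]
    rw [symm (D (e i)), symm (D (e j))]
    linarith
  exact congrArg (fun F => F u v) h8

theorem trace_eq_zero_of_skew (B : V →ₗ[ℝ] V →ₗ[ℝ] ℝ)
    (symm : ∀ u v, B u v = B v u) (posdef : ∀ u, u ≠ 0 → 0 < B u u) (D : V →ₗ[ℝ] V)
    (hD : ∀ u, B (D u) u = 0) : LinearMap.trace ℝ V D = 0 := by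
  obtain ⟨e, he⟩ := exists_orthonormal_basis_of_posdef B symm posdef
  rw [trace_eq_sum_bilin he]
  exact Finset.sum_eq_zero fun i _ => by rw [symm, hD]

end OrthonormalBases

section HermitianMetrics

variable {L : Type*} [LieRing L] [LieAlgebra ℝ L] {J : L →ₗ[ℝ] L}

namespace HermMetric

theorem dcOmega_eq (g : HermMetric J) (u v w : L) :
    g.dcOmega u v w = g.B ⁅J u, J v⁆ w - g.B ⁅J u, J w⁆ v + g.B ⁅J v, J w⁆ u := by
  simp only [dcOmega, dOmega, omega, g.compat]
  ring

theorem sum_dOmega (hJ : IsComplexStructure J) (g : HermMetric J) {ι : Type*} [Fintype ι]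
    [DecidableEq ι] (f : Basis ι ℝ L) (hf : ∀ i j, g.B (f i) (f j) = if i = j then 1 else 0)
    (z : L) : ∑ k, g.dOmega (f k) (J (f k)) z =
      - g.B (J (∑ k, ⁅f k, J (f k)⁆)) z - 2 * LinearMap.trace ℝ L (LieAlgebra.ad ℝ L z) := by
  let Jequiv : L ≃ₗ[ℝ] L := LinearEquiv.ofLinearMap J (-J)
    (LinearMap.ext fun u => by simp [hJ.1]) (LinearMap.ext fun u => by simp [hJ.1])
  have hJf : ∀ i j, g.B (f.map Jequiv i) (f.map Jequiv j) = if i = j then 1 else 0 :=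
    fun i j => (g.compat (f i) (f j)).trans (hf i j)
  have h1 := trace_eq_sum_bilin hf (LieAlgebra.ad ℝ L z)
  have h2 := trace_eq_sum_bilin hJf (LieAlgebra.ad ℝ L z)
  have h3 : ∀ k, g.dOmega (f k) (J (f k)) z = - g.B (J ⁅f k, J (f k)⁆) z
      - g.B (f k) ⁅z, f k⁆ - g.B (J (f k)) ⁅z, J (f k)⁆ := fun k => by
    have h4 := g.compat (J ⁅J (f k), z⁆) (f k)
    rw [hJ.1] at h4
    simp only [dOmega, omega, ← h4, g.compat]
    rw [g.symm (f k), g.symm (J (f k)), ← lie_skew (f k) z, ← lie_skew (J (f k)) z]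
    simp only [map_neg, LinearMap.neg_apply]
    ring
  simp only [h3, Finset.sum_sub_distrib, Finset.sum_neg_distrib]
  rw [two_mul]
  nth_rw 1 [h1]
  rw [h2, map_sum, map_sum, LinearMap.sum_apply]
  simp only [LieAlgebra.ad_apply, Basis.map_apply]
  change _ - _ - _ = _ - (_ + ∑ k, g.B (J (f k)) ⁅z, J (f k)⁆)
  ring

/-- On a unimodular Lie algebra, a balanced metric satisfies `∑ [fₖ, J fₖ] = 0`. -/
theorem IsBalanced.sum_lie_eq_zero_s12 (hJ : IsComplexStructure J) (huni : IsUnimodularLie L)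
    {g : HermMetric J} {n : ℕ} (hg : g.IsBalanced n) (f : Basis (Fin (2 * n)) ℝ L)
    (hf : ∀ i j, g.B (f i) (f j) = if i = j then 1 else 0) : ∑ k, ⁅f k, J (f k)⁆ = 0 := by
  set s := ∑ k, ⁅f k, J (f k)⁆ with hs
  have h := hg f hf (J s)
  rw [g.sum_dOmega hJ f hf, huni, ← hs, g.compat] at h
  by_contra hne
  linarith [g.posdef s hne]

end HermMetric

end HermitianMetrics

section Frames

variable {L : Type*} [LieRing L] [LieAlgebra ℝ L]

/-- Linear forms `α, β` cutting out an abelian ideal `a` of codimension two, with `β` vanishing on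
the commutator, and vectors `x, y ∈ a` such that `(x, y, Jx, Jy)` is dual to
`(α ∘ J, β ∘ J, α, β)`, the complex structure being degenerate. -/
structure DegenerateFrame (J : L →ₗ[ℝ] L) where
  α : L →ₗ[ℝ] ℝ
  β : L →ₗ[ℝ] ℝ
  x : L
  y : L
  α_x : α x = 0
  β_x : β x = 0
  α_y : α y = 0
  β_y : β y = 0
  α_Jx : α (J x) = 1
  β_Jx : β (J x) = 0
  α_Jy : α (J y) = 0
  β_Jy : β (J y) = 1
  β_lie : ∀ u v : L, β ⁅u, v⁆ = 0
  α_lie : ∀ u v : L, α v = 0 → β v = 0 → α ⁅u, v⁆ = 0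
  lie_eq_zero : ∀ u v : L, α u = 0 → β u = 0 → α v = 0 → β v = 0 → ⁅u, v⁆ = 0
  exists_α_lie_ne : ∃ u v : L, α ⁅u, v⁆ ≠ 0
  degenerate : ∀ u v : L, α u = 0 → β u = 0 → β (J u) = 0 → α v = 0 → β v = 0 →
    α (J ⁅J u, v⁆) = 0 ∧ β (J ⁅J u, v⁆) = 0

namespace DegenerateFrame

variable {J : L →ₗ[ℝ] L} (F : DegenerateFrame J)

/-- The maximal `J`-invariant subspace `a ∩ J a`. -/
def core : Submodule ℝ L :=
  LinearMap.ker F.α ⊓ LinearMap.ker F.β ⊓ LinearMap.ker (F.α ∘ₗ J) ⊓ LinearMap.ker (F.β ∘ₗ J)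

theorem mem_core {u : L} :
    u ∈ F.core ↔ F.α u = 0 ∧ F.β u = 0 ∧ F.α (J u) = 0 ∧ F.β (J u) = 0 := by
  simp [core, and_assoc]

theorem J_mem_core (hJ : IsComplexStructure J) {u : L} (hu : u ∈ F.core) : J u ∈ F.core := by
  rw [mem_core] at hu ⊢
  simp [hJ.1, hu]

theorem lie_J_of_mem_core (hJ : IsComplexStructure J) {w u : L} (hwα : F.α w = 0)
    (hwβ : F.β w = 0) (hu : u ∈ F.core) : ⁅J w, J u⁆ = J ⁅J w, u⁆ := by
  have hu' := F.mem_core.mp hu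
  have h := hJ.2 w u
  rw [F.lie_eq_zero w u hwα hwβ hu'.1 hu'.2.1,
    F.lie_eq_zero w (J u) hwα hwβ hu'.2.2.1 hu'.2.2.2, map_zero, add_zero, zero_sub] at h
  exact (neg_add_eq_zero.mp h)

theorem lie_mem_core (hJ : IsComplexStructure J) {w u : L} (hwα : F.α w = 0)
    (hwβ : F.β w = 0) (hu : u ∈ F.core) : ⁅J w, u⁆ ∈ F.core := by
  have hu' := F.mem_core.mp hu
  refine F.mem_core.mpr ⟨F.α_lie _ _ hu'.1 hu'.2.1, F.β_lie _ _, ?_, ?_⟩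
  · rw [← F.lie_J_of_mem_core hJ hwα hwβ hu]
    exact F.α_lie _ _ hu'.2.2.1 hu'.2.2.2
  · rw [← F.lie_J_of_mem_core hJ hwα hwβ hu]
    exact F.β_lie _ _

theorem lie_Jx_mem_core {v : L} (hα : F.α v = 0) (hβ : F.β v = 0) : ⁅J F.x, v⁆ ∈ F.core :=
  F.mem_core.mpr ⟨F.α_lie _ _ hα hβ, F.β_lie _ _,
    F.degenerate _ _ F.α_x F.β_x F.β_Jx hα hβ⟩

theorem lie_Jx_Jy (hJ : IsComplexStructure J) :
    ⁅J F.x, J F.y⁆ = J (⁅J F.x, F.y⁆ - ⁅J F.y, F.x⁆) := by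
  have h := hJ.2 F.x F.y
  rw [F.lie_eq_zero _ _ F.α_x F.β_x F.α_y F.β_y, ← lie_skew F.x (J F.y), map_neg, zero_sub] at h
  rw [map_sub, ← sub_eq_zero, ← neg_eq_zero, ← h]
  abel

theorem β_J_lie_Jy_x (hJ : IsComplexStructure J) : F.β (J ⁅J F.y, F.x⁆) = 0 := by
  have h := F.β_lie (J F.x) (J F.y)
  rw [F.lie_Jx_Jy hJ, map_sub, map_sub,
    (F.mem_core.mp (F.lie_Jx_mem_core F.α_y F.β_y)).2.2.2] at h
  linarith

theorem α_lie_Jx_Jy (hJ : IsComplexStructure J) :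
    F.α ⁅J F.x, J F.y⁆ = - F.α (J ⁅J F.y, F.x⁆) := by
  rw [F.lie_Jx_Jy hJ, map_sub, map_sub,
    (F.mem_core.mp (F.lie_Jx_mem_core F.α_y F.β_y)).2.2.1, zero_sub]

theorem sub_mem_core (hJ : IsComplexStructure J) (u : L) :
    u - F.α (J u) • F.x - F.β (J u) • F.y - F.α u • J F.x - F.β u • J F.y ∈ F.core := by
  rw [mem_core]
  simp [hJ.1, F.α_x, F.β_x, F.α_y, F.β_y, F.α_Jx, F.β_Jx, F.α_Jy, F.β_Jy]

/-- Every vector is a combination of `Jx`, `Jy`, `x`, `y` and a vector of the core. -/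
theorem exists_decomposition (hJ : IsComplexStructure J) (u : L) : ∃ w ∈ F.core,
    u = F.α u • J F.x + F.β u • J F.y + (F.α (J u) • F.x + F.β (J u) • F.y + w) :=
  ⟨_, F.sub_mem_core hJ u, by abel⟩

theorem α_lie_eq (hJ : IsComplexStructure J) (u v : L) :
    F.α ⁅u, v⁆ = (F.α u * F.β v - F.α v * F.β u) * F.α ⁅J F.x, J F.y⁆ := by
  obtain ⟨w, hw, hu⟩ := F.exists_decomposition hJ u
  obtain ⟨z, hz, hv⟩ := F.exists_decomposition hJ v
  have hw' := F.mem_core.mp hw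
  have hz' := F.mem_core.mp hz
  generalize hs : F.α (J u) • F.x + F.β (J u) • F.y + w = s at hu
  generalize ht : F.α (J v) • F.x + F.β (J v) • F.y + z = t at hv
  have hsα : F.α s = 0 := by simp [← hs, F.α_x, F.α_y, hw']
  have hsβ : F.β s = 0 := by simp [← hs, F.β_x, F.β_y, hw']
  have htα : F.α t = 0 := by simp [← ht, F.α_x, F.α_y, hz']
  have htβ : F.β t = 0 := by simp [← ht, F.β_x, F.β_y, hz']
  have hleft : ∀ r, F.α ⁅s, r⁆ = 0 := fun r => by
    rw [← lie_skew, map_neg, F.α_lie _ _ hsα hsβ, neg_zero]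
  have hright : ∀ r, F.α ⁅r, t⁆ = 0 := fun r => F.α_lie _ _ htα htβ
  conv_lhs => rw [hu, hv]
  simp only [add_lie, lie_add, smul_lie, lie_smul, map_add, map_smul, hleft, hright, lie_self,
    map_zero, smul_eq_mul]
  rw [← lie_skew (J F.y) (J F.x), map_neg]
  ring

theorem α_J_lie_Jy_x_ne_zero (hJ : IsComplexStructure J) : F.α (J ⁅J F.y, F.x⁆) ≠ 0 := by
  intro h
  obtain ⟨u, v, huv⟩ := F.exists_α_lie_ne
  exact huv (by rw [F.α_lie_eq hJ, F.α_lie_Jx_Jy hJ, h, neg_zero, mul_zero])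

/-- The `y`-component of the bracket is `d • (β ∧ (β ∘ J))`, where `d` is the `y`-component of
`[Jy, y]`. -/
theorem β_J_lie_eq (hJ : IsComplexStructure J) (u v : L) :
    F.β (J ⁅u, v⁆) = F.β (J ⁅J F.y, F.y⁆) * (F.β u * F.β (J v) - F.β v * F.β (J u)) := by
  obtain ⟨w, hw, hu⟩ := F.exists_decomposition hJ u
  obtain ⟨z, hz, hv⟩ := F.exists_decomposition hJ v
  have hw' := F.mem_core.mp hw
  have hz' := F.mem_core.mp hz
  have key : ∀ (s : ℝ) (t : ℝ) (r : L), r ∈ F.core → ∀ p : L, p = s • F.x + t • F.y + r →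
      F.α p = 0 ∧ F.β p = 0 ∧ F.β (J ⁅J F.x, p⁆) = 0 ∧
        F.β (J ⁅J F.y, p⁆) = t * F.β (J ⁅J F.y, F.y⁆) := by
    intro s t r hr p hp
    have hr' := F.mem_core.mp hr
    have hα : F.α p = 0 := by simp [hp, F.α_x, F.α_y, hr']
    have hβ : F.β p = 0 := by simp [hp, F.β_x, F.β_y, hr']
    refine ⟨hα, hβ, (F.mem_core.mp (F.lie_Jx_mem_core hα hβ)).2.2.2, ?_⟩
    have h1 := (F.mem_core.mp (F.lie_mem_core hJ F.α_y F.β_y hr)).2.2.2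
    simp [hp, h1, F.β_J_lie_Jy_x hJ]
  obtain ⟨hsα, hsβ, hsx, hsy⟩ := key (F.α (J u)) (F.β (J u)) w hw _ rfl
  obtain ⟨htα, htβ, htx, hty⟩ := key (F.α (J v)) (F.β (J v)) z hz _ rfl
  generalize F.α (J u) • F.x + F.β (J u) • F.y + w = s at hu hsα hsβ hsx hsy
  generalize F.α (J v) • F.x + F.β (J v) • F.y + z = t at hv htα htβ htx hty
  have hxy : F.β (J ⁅J F.x, J F.y⁆) = 0 := by
    rw [F.lie_Jx_Jy hJ, hJ.1, map_neg, map_sub, F.β_lie, F.β_lie]; simp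
  conv_lhs => rw [hu, hv]
  simp only [add_lie, lie_add, smul_lie, lie_smul, map_add, map_smul, lie_self,
    F.lie_eq_zero s t hsα hsβ htα htβ, map_zero, smul_eq_mul]
  rw [← lie_skew (J F.y) (J F.x), ← lie_skew s (J F.x), ← lie_skew s (J F.y)]
  simp only [map_neg, hxy, hsx, hsy, htx, hty]
  ring

theorem trace_ad_Jy [FiniteDimensional ℝ L] (hJ : IsComplexStructure J) (T : F.core →ₗ[ℝ] F.core)
    (hT : ∀ u : F.core, (T u : L) = ⁅J F.y, (u : L)⁆) :
    LinearMap.trace ℝ L (LieAlgebra.ad ℝ L (J F.y)) =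
      LinearMap.trace ℝ F.core T + 2 * F.α (J ⁅J F.y, F.x⁆) + F.β (J ⁅J F.y, F.y⁆) := by
  set A := LieAlgebra.ad ℝ L (J F.y) with hA
  set A' : L →ₗ[ℝ] L := A - (F.α ∘ₗ J).smulRight (A F.x) - (F.β ∘ₗ J).smulRight (A F.y)
    - F.α.smulRight (A (J F.x)) - F.β.smulRight (A (J F.y)) with hA'
  have hmem : ∀ u, A' u ∈ F.core := fun u => by
    have h : A' u = ⁅J F.y, u - F.α (J u) • F.x - F.β (J u) • F.y - F.α u • J F.x
        - F.β u • J F.y⁆ := by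
      simp [hA', hA]
    rw [h]
    exact F.lie_mem_core hJ F.α_y F.β_y (F.sub_mem_core hJ u)
  have hrestrict : A'.restrict (fun u _ => hmem u) = T := by
    ext u
    have hu := F.mem_core.mp u.2
    simp [hA', hA, hu, hT]
  have h := LinearMap.trace_restrict_eq_of_forall_mem F.core A' hmem
  rw [hrestrict] at h
  have hα : F.α ⁅J F.y, J F.x⁆ = F.α (J ⁅J F.y, F.x⁆) := by
    rw [← lie_skew, map_neg, F.α_lie_Jx_Jy hJ, neg_neg]
  rw [h, hA']
  simp only [map_sub, LinearMap.trace_smulRight, hA, LieAlgebra.ad_apply, LinearMap.comp_apply,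
    hα, lie_self, map_zero]
  ring

/-- The pluriclosed condition evaluated on `(u, Ju, w, Jw)`. -/
theorem normSq_add_sq_add_eq_zero (hJ : IsComplexStructure J) {g : HermMetric J}
    (hg : g.IsPluriclosed) {w u : L} (hwα : F.α w = 0) (hwβ : F.β w = 0) (hu : u ∈ F.core) :
    g.B ⁅J w, u⁆ ⁅J w, u⁆ + g.B ⁅J w, ⁅J w, u⁆⁆ u + g.B ⁅J ⁅J w, w⁆, u⁆ u = 0 := by
  have hcore : ∀ p ∈ F.core, ∀ q ∈ F.core, ⁅p, q⁆ = 0 := fun p hp q hq => by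
    have hp := F.mem_core.mp hp
    have hq := F.mem_core.mp hq
    exact F.lie_eq_zero p q hp.1 hp.2.1 hq.1 hq.2.1
  have hcw : ∀ p ∈ F.core, ⁅p, w⁆ = 0 := fun p hp => by
    have hp := F.mem_core.mp hp
    exact F.lie_eq_zero p w hp.1 hp.2.1 hwα hwβ
  have hcα : F.α ⁅J w, w⁆ = 0 := F.α_lie _ _ hwα hwβ
  have hcβ : F.β ⁅J w, w⁆ = 0 := F.β_lie _ _
  have hJu := F.J_mem_core hJ hu
  have hp := F.lie_mem_core hJ hwα hwβ hu
  have hJp := F.J_mem_core hJ hp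
  have e1 := F.lie_J_of_mem_core hJ hwα hwβ hu
  have e2 := F.lie_J_of_mem_core hJ hwα hwβ hp
  have e3 := F.lie_J_of_mem_core hJ hcα hcβ hu
  have h := hg u (J u) w (J w)
  simp only [HermMetric.ddcOmega, hcore u hu _ hJu, hcw u hu, hcw _ hJu] at h
  rw [← lie_skew u (J w), ← lie_skew (J u) (J w), ← lie_skew w (J w), e1] at h
  generalize hpdef : ⁅J w, u⁆ = p at *
  generalize ⁅J w, w⁆ = c at *
  have e4 : ⁅J p, J w⁆ = - J ⁅J w, p⁆ := by rw [← lie_skew, e2]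
  have e5 : ⁅p, J w⁆ = - ⁅J w, p⁆ := by rw [← lie_skew]
  have e6 : ⁅J u, J w⁆ = - J p := by rw [← lie_skew, e1]
  have e7 : ⁅u, J w⁆ = - p := by rw [← lie_skew, hpdef]
  simp only [HermMetric.dcOmega_eq, map_neg, map_zero, hJ.1, neg_lie, lie_neg, zero_lie,
    neg_neg, LinearMap.neg_apply, LinearMap.zero_apply, e3, e4, e5, e6, e7, g.compat,
    hcore _ hJp u hu, hcore p hp _ hJu, hcore _ hJu u hu] at h
  linarith

/-- A pluriclosed metric forces the `y`-component of `[Jy, y]` to be nonzero. -/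
theorem β_J_lie_Jy_y_ne_zero [FiniteDimensional ℝ L] (hJ : IsComplexStructure J)
    (huni : IsUnimodularLie L) {g : HermMetric J} (hg : g.IsPluriclosed) :
    F.β (J ⁅J F.y, F.y⁆) ≠ 0 := by
  intro hd
  let b : F.core →ₗ[ℝ] F.core →ₗ[ℝ] ℝ := g.B.domRestrict₁₂ F.core F.core
  have hbsymm : ∀ u v, b u v = b v u := fun u v => g.symm u v
  have hbpos : ∀ u, u ≠ 0 → 0 < b u u := fun u hu => g.posdef u (by simpa using hu)
  let N : F.core →ₗ[ℝ] F.core := (LieAlgebra.ad ℝ L (J F.x)).restrict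
    fun u hu => F.lie_mem_core hJ F.α_x F.β_x hu
  let D : F.core →ₗ[ℝ] F.core := (LieAlgebra.ad ℝ L (J F.y)).restrict
    fun u hu => F.lie_mem_core hJ F.α_y F.β_y hu
  have skew : ∀ T : F.core →ₗ[ℝ] F.core, (∀ u, b (T u) (T u) + b (T (T u)) u = 0) →
      ∀ u, b (T u) u = 0 := fun T hT u => by
    linarith [skew_of_normSq_add_sq_eq_zero b hbsymm hbpos T hT u u]
  have hlie : ∀ p ∈ F.core, ∀ q ∈ F.core, ⁅p, q⁆ = 0 := fun p hp q hq => by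
    have hp := F.mem_core.mp hp
    have hq := F.mem_core.mp hq
    exact F.lie_eq_zero p q hp.1 hp.2.1 hq.1 hq.2.1
  have hN : ∀ u, b (N u) u = 0 := skew N fun u => by
    have h := F.normSq_add_sq_add_eq_zero hJ hg F.α_x F.β_x u.2
    rw [hlie _ (F.J_mem_core hJ (F.lie_Jx_mem_core F.α_x F.β_x)) u u.2, map_zero,
      LinearMap.zero_apply, add_zero] at h
    exact h
  have hD : ∀ u, b (D u) u = 0 := skew D fun u => by
    have h := F.normSq_add_sq_add_eq_zero hJ hg F.α_y F.β_y u.2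
    obtain ⟨w, hw, hc⟩ := F.exists_decomposition hJ ⁅J F.y, F.y⁆
    rw [F.α_lie _ _ F.α_y F.β_y, F.β_lie, hd] at hc
    have hlast : g.B ⁅J ⁅J F.y, F.y⁆, (u : L)⁆ u = 0 := by
      rw [hc]
      simp only [map_add, map_smul, add_lie, smul_lie, hlie _ (F.J_mem_core hJ hw) u u.2, zero_smul,
        zero_add, add_zero, LinearMap.smul_apply]
      rw [show g.B ⁅J F.x, (u : L)⁆ u = 0 from hN u, smul_zero]
    rw [hlast, add_zero] at h
    exact h
  have htr := F.trace_ad_Jy hJ D fun u => rfl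
  rw [huni, trace_eq_zero_of_skew b hbsymm hbpos D hD, hd] at htr
  exact F.α_J_lie_Jy_x_ne_zero hJ (by linarith)

/-- A balanced metric forces the `y`-component of `[Jy, y]` to vanish. -/
theorem β_J_lie_Jy_y_eq_zero_of_isBalanced [FiniteDimensional ℝ L] (hJ : IsComplexStructure J)
    (huni : IsUnimodularLie L) {n : ℕ} (hdim : finrank ℝ L = 2 * n) {g : HermMetric J}
    (hg : g.IsBalanced n) : F.β (J ⁅J F.y, F.y⁆) = 0 := by
  obtain ⟨e, he⟩ := exists_orthonormal_basis_of_posdef g.B g.symm g.posdef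
  let f : Basis (Fin (2 * n)) ℝ L := e.reindex (finCongr hdim)
  have hf : ∀ i j, g.B (f i) (f j) = if i = j then 1 else 0 := fun i j => by
    rw [Basis.reindex_apply, Basis.reindex_apply, he]
    exact if_congr (EmbeddingLike.apply_eq_iff_eq _) rfl rfl
  have hterm : ∀ k, F.β (J ⁅f k, J (f k)⁆) =
      - F.β (J ⁅J F.y, F.y⁆) * (F.β (f k) ^ 2 + F.β (J (f k)) ^ 2) := fun k => by
    rw [F.β_J_lie_eq hJ, hJ.1, map_neg]
    ring
  have hsum := congrArg (fun v => F.β (J v)) (hg.sum_lie_eq_zero_s12 hJ huni f hf)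
  simp only [map_sum, map_zero] at hsum
  rw [Finset.sum_congr rfl fun k _ => hterm k, ← Finset.mul_sum] at hsum
  refine neg_eq_zero.mp ((mul_eq_zero.mp hsum).resolve_right fun h => ?_)
  have hzero : F.β = 0 := f.ext fun k => by
    have hk := (Finset.sum_eq_zero_iff_of_nonneg fun k _ => by positivity).mp h k
      (Finset.mem_univ _)
    rw [LinearMap.zero_apply]
    nlinarith [sq_nonneg (F.β (f k)), sq_nonneg (F.β (J (f k)))]
  have := F.β_Jy
  rw [hzero] at this
  simp at this

end DegenerateFrame

/-- An abelian ideal of codimension two not containing `[L, L]` is cut out by two linear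
forms, one of which cuts out the span of the ideal and the commutators. -/
theorem exists_forms_of_codim_two [FiniteDimensional ℝ L] (a : LieIdeal ℝ L)
    (hcodim : finrank ℝ a.toSubmodule + 2 = finrank ℝ L)
    (hnonab : ¬ ∀ u v : L, ⁅u, v⁆ ∈ a.toSubmodule) :
    ∃ (α β : L →ₗ[ℝ] ℝ) (r : L), α r = 1 ∧ β r = 0 ∧ β ≠ 0 ∧ (∀ u v : L, β ⁅u, v⁆ = 0) ∧
      (∀ u, u ∈ a.toSubmodule ↔ α u = 0 ∧ β u = 0) ∧
      ∀ u, u ∈ a.toSubmodule ⊔ Submodule.span ℝ {z : L | ∃ u v : L, ⁅u, v⁆ = z} ↔ β u = 0 := by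
  have hquot : finrank ℝ (L ⧸ a.toSubmodule) = 2 := by
    have := a.toSubmodule.finrank_quotient_add_finrank
    omega
  let q := finBasisOfFinrankEq ℝ (L ⧸ a.toSubmodule) hquot
  obtain ⟨z₁, hz₁⟩ := a.toSubmodule.mkQ_surjective (q 0)
  obtain ⟨z₂, hz₂⟩ := a.toSubmodule.mkQ_surjective (q 1)
  have hdec : ∀ u : L, ∃ (s t : ℝ) (w : L), w ∈ a.toSubmodule ∧ u = s • z₁ + t • z₂ + w := by
    intro u
    refine ⟨q.repr (a.toSubmodule.mkQ u) 0, q.repr (a.toSubmodule.mkQ u) 1, _, ?_,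
      (add_sub_cancel _ u).symm⟩
    refine (Submodule.Quotient.mk_eq_zero a.toSubmodule).mp ?_
    rw [← Submodule.mkQ_apply, map_sub, map_add, map_smul, map_smul,
      hz₁, hz₂, ← Fin.sum_univ_two (fun i => q.repr (a.toSubmodule.mkQ u) i • q i), q.sum_repr,
      sub_self]
  have hleft : ∀ u v, u ∈ a.toSubmodule → ⁅u, v⁆ ∈ a.toSubmodule :=
    fun u v hu => lie_mem_left ℝ L a u v hu
  have hright : ∀ u v, v ∈ a.toSubmodule → ⁅u, v⁆ ∈ a.toSubmodule :=
    fun u v hv => lie_mem_right ℝ L a u v hv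
  have hlie : ∀ u v : L, ∃ c : ℝ, ⁅u, v⁆ - c • ⁅z₁, z₂⁆ ∈ a.toSubmodule := by
    intro u v
    obtain ⟨s, t, w, hw, hu⟩ := hdec u
    obtain ⟨s', t', w', hw', hv⟩ := hdec v
    refine ⟨s * t' - t * s', ?_⟩
    have h : ⁅u, v⁆ - (s * t' - t * s') • ⁅z₁, z₂⁆ = ⁅u, w'⁆ + ⁅w, s' • z₁ + t' • z₂⁆ := by
      rw [hv, hu]
      simp only [add_lie, lie_add, smul_lie, lie_smul, lie_self]
      rw [← lie_skew z₂ z₁]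
      module
    rw [h]
    exact add_mem (hright _ _ hw') (hleft _ _ hw)
  set r₀ := ⁅z₁, z₂⁆ with hr₀
  have hr₀a : r₀ ∉ a.toSubmodule := fun hr => hnonab fun u v => by
    obtain ⟨c, hc⟩ := hlie u v
    simpa using add_mem hc (a.toSubmodule.smul_mem c hr)
  obtain ⟨α, hαr, hα⟩ := Submodule.exists_le_ker_of_notMem hr₀a
  have hlt : a.toSubmodule ⊔ Submodule.span ℝ {r₀} < ⊤ := by
    refine lt_top_iff_ne_top.mpr fun h => ?_
    have h1 := Submodule.finrank_add_le_finrank_add_finrank a.toSubmodule (Submodule.span ℝ {r₀})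
    have h2 := finrank_span_le_card (R := ℝ) ({r₀} : Set L)
    rw [h, finrank_top] at h1
    simp only [Set.toFinset_singleton, Finset.card_singleton] at h2
    omega
  obtain ⟨β, hβ0, hβ⟩ := Submodule.exists_le_ker_of_lt_top _ hlt
  have hβr : β r₀ = 0 :=
    hβ (Submodule.mem_sup_right (Submodule.mem_span_singleton_self r₀))
  have hβa : ∀ u ∈ a.toSubmodule, β u = 0 := fun u hu => hβ (Submodule.mem_sup_left hu)
  have hβlie : ∀ u v : L, β ⁅u, v⁆ = 0 := fun u v => by
    obtain ⟨c, hc⟩ := hlie u v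
    simpa [hβr] using hβa _ hc
  have hmem : ∀ u, u ∈ a.toSubmodule ↔ α u = 0 ∧ β u = 0 := by
    intro u
    refine ⟨fun hu => ⟨hα hu, hβa u hu⟩, fun hu => ?_⟩
    obtain ⟨s, t, w, hw, hu'⟩ := hdec u
    obtain ⟨c₁, c₂, w₀, hw₀, hr⟩ := hdec r₀
    have h1 : s * α z₁ + t * α z₂ = 0 := by
      simpa [hu', show α w = 0 from hα hw] using hu.1
    have h2 : s * β z₁ + t * β z₂ = 0 := by
      simpa [hu', hβa w hw] using hu.2
    have h3 : c₁ * α z₁ + c₂ * α z₂ ≠ 0 := by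
      rw [hr] at hαr
      simpa [show α w₀ = 0 from hα hw₀] using hαr
    have h4 : c₁ * β z₁ + c₂ * β z₂ = 0 := by
      rw [hr] at hβr
      simpa [hβa w₀ hw₀] using hβr
    have hdet : α z₁ * β z₂ - α z₂ * β z₁ ≠ 0 := fun hdet => by
      have hb₁ : β z₁ = 0 := (mul_eq_zero.mp (show (c₁ * α z₁ + c₂ * α z₂) * β z₁ = 0 by
        linear_combination α z₁ * h4 - c₂ * hdet)).resolve_left h3
      have hb₂ : β z₂ = 0 := (mul_eq_zero.mp (show (c₁ * α z₁ + c₂ * α z₂) * β z₂ = 0 by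
        linear_combination α z₂ * h4 + c₁ * hdet)).resolve_left h3
      refine hβ0 (LinearMap.ext fun v => ?_)
      obtain ⟨s', t', w', hw', hv⟩ := hdec v
      simp [hv, hb₁, hb₂, hβa w' hw']
    have hs : s = 0 := (mul_eq_zero.mp (show s * (α z₁ * β z₂ - α z₂ * β z₁) = 0 by
      linear_combination β z₂ * h1 - α z₂ * h2)).resolve_right hdet
    have ht : t = 0 := (mul_eq_zero.mp (show t * (α z₁ * β z₂ - α z₂ * β z₁) = 0 by
      linear_combination α z₁ * h2 - β z₁ * h1)).resolve_right hdet
    rwa [hu', hs, ht, zero_smul, zero_smul, add_zero, zero_add]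
  refine ⟨(α r₀)⁻¹ • α, β, r₀, by simp [hαr], hβr, hβ0, hβlie, fun u => by simp [hmem, hαr], ?_⟩
  intro u
  constructor
  · intro hu
    have : a.toSubmodule ⊔ Submodule.span ℝ {z : L | ∃ u v : L, ⁅u, v⁆ = z} ≤ LinearMap.ker β := by
      refine sup_le hβa (Submodule.span_le.mpr ?_)
      rintro _ ⟨v, w, rfl⟩
      exact hβlie v w
    exact this hu
  · intro hu
    rw [← sub_add_cancel u ((α u / α r₀) • r₀)]
    refine add_mem (Submodule.mem_sup_left ((hmem _).mpr ?_)) (Submodule.smul_mem _ _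
      (Submodule.mem_sup_right (Submodule.subset_span ⟨z₁, z₂, rfl⟩)))
    simp [hβr, hu, hαr]

theorem mem_inf_map_iff {J : L →ₗ[ℝ] L} (hJ : ∀ u, J (J u) = - u) (P Q : Submodule ℝ L) (u : L) :
    u ∈ P ⊓ Q.map J ↔ u ∈ P ∧ J u ∈ Q := by
  rw [Submodule.mem_inf, Submodule.mem_map]
  refine and_congr_right fun _ => ⟨?_, fun h => ⟨-J u, neg_mem h, by simp [hJ]⟩⟩
  rintro ⟨v, hv, rfl⟩
  rw [hJ]
  exact neg_mem hv

/-- A degenerate complex structure not preserving a codimension-two abelian ideal `a`, with `[L, L]`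
not contained in `a`, admits a degenerate frame. -/
theorem exists_degenerateFrame [FiniteDimensional ℝ L] (a : LieIdeal ℝ L)
    (habel : ∀ u ∈ a.toSubmodule, ∀ v ∈ a.toSubmodule, ⁅u, v⁆ = (0 : L))
    (hcodim : finrank ℝ a.toSubmodule + 2 = finrank ℝ L)
    (J : L →ₗ[ℝ] L) (hJ : IsComplexStructure J)
    (hJa : a.toSubmodule.map J ≠ a.toSubmodule)
    (hnonab : ¬ ∀ u v : L, ⁅u, v⁆ ∈ a.toSubmodule)
    (hdeg : ∀ u ∈ a.toSubmodule ⊓ (a.toSubmodule ⊔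
        Submodule.span ℝ {z : L | ∃ u v : L, ⁅u, v⁆ = z}).map J, ∀ v ∈ a.toSubmodule,
      ⁅J u, v⁆ ∈ a.toSubmodule ⊓ a.toSubmodule.map J) :
    ∃ F : DegenerateFrame J, (∀ u, u ∈ a.toSubmodule ↔ F.α u = 0 ∧ F.β u = 0) ∧
      ∀ u, u ∈ a.toSubmodule ⊔ Submodule.span ℝ {z : L | ∃ u v : L, ⁅u, v⁆ = z} ↔ F.β u = 0 := by
  obtain ⟨α₀, β, r, hα₀r, hβr, hβ0, hβlie, hmem₀, hmem'⟩ :=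
    exists_forms_of_codim_two a hcodim hnonab
  have hy : ∃ y ∈ a.toSubmodule, β (J y) ≠ 0 := by
    by_contra! hcon
    obtain ⟨y, hya, hJy⟩ : ∃ y ∈ a.toSubmodule, J y ∉ a.toSubmodule := by
      by_contra! h
      refine hJa (le_antisymm (Submodule.map_le_iff_le_comap.mpr h) fun v hv => ?_)
      exact ⟨-J v, neg_mem (h v hv), by simp [hJ.1]⟩
    have hαJy : α₀ (J y) ≠ 0 := fun h => hJy ((hmem₀ _).mpr ⟨h, hcon y hya⟩)
    have hinv : ∀ v, β v = 0 → β (J v) = 0 := fun v hv => by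
      have h := hcon (v - (α₀ v / α₀ (J y)) • J y)
        ((hmem₀ _).mpr ⟨by simp [hαJy], by simp [hv, hcon y hya]⟩)
      simpa [hJ.1, ((hmem₀ y).mp hya).2] using h
    refine hβ0 (LinearMap.ext fun z => ?_)
    by_contra hz
    rw [LinearMap.zero_apply] at hz
    have h := hinv (β z • J z - β (J z) • z) (by simp; ring)
    simp only [map_sub, map_smul, hJ.1, map_neg, smul_eq_mul] at h
    nlinarith [sq_nonneg (β (J z)), pow_pos (abs_pos.mpr hz) 2, sq_abs (β z)]
  obtain ⟨y₀, hy₀, hβJy₀⟩ := hy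
  obtain ⟨y, hya, hβJy⟩ : ∃ y ∈ a.toSubmodule, β (J y) = 1 :=
    ⟨(β (J y₀))⁻¹ • y₀, Submodule.smul_mem _ _ hy₀, by simp [hβJy₀]⟩
  have hβy : β y = 0 := ((hmem₀ y).mp hya).2
  let α : L →ₗ[ℝ] ℝ := α₀ - α₀ (J y) • β
  have hmem : ∀ u, u ∈ a.toSubmodule ↔ α u = 0 ∧ β u = 0 := fun u => by
    rw [hmem₀]
    refine and_congr_left fun h => ?_
    simp [α, h]
  have hαJy : α (J y) = 0 := by simp [α, hβJy]
  have hαy : α y = 0 := ((hmem y).mp hya).1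
  have hx : ∃ x, α x = 0 ∧ β x = 0 ∧ β (J x) = 0 ∧ α (J x) ≠ 0 := by
    by_contra! hcon
    have hαr : α r = 1 := by simp [α, hβr, hα₀r]
    let w := r - β (J r) • y
    have hαw : α w = 1 := by simp [w, hαr, hαy]
    have hβw : β w = 0 := by simp [w, hβr, hβy]
    have hβJw : β (J w) = 0 := by simp [w, hβJy]
    have h := hcon (J w - α (J w) • w) (by simp [hαw]) (by simp [hβw, hβJw])
      (by simp [hJ.1, hβw, hβJw])
    simp only [map_sub, map_smul, hJ.1, map_neg, hαw, smul_eq_mul] at h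
    nlinarith [sq_nonneg (α (J w))]
  obtain ⟨x₀, hαx₀, hβx₀, hβJx₀, hαJx₀⟩ := hx
  have hright : ∀ u v, v ∈ a.toSubmodule → ⁅u, v⁆ ∈ a.toSubmodule :=
    fun u v hv => lie_mem_right ℝ L a u v hv
  refine ⟨{ α := α, β := β, x := (α (J x₀))⁻¹ • x₀, y := y
            α_x := by simp [hαx₀]
            β_x := by simp [hβx₀]
            α_y := hαy
            β_y := hβy
            α_Jx := by simp [hαJx₀]
            β_Jx := by simp [hβJx₀]
            α_Jy := hαJy
            β_Jy := hβJy
            β_lie := hβlie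
            α_lie := fun u v h₁ h₂ => ((hmem _).mp (hright u v ((hmem v).mpr ⟨h₁, h₂⟩))).1
            lie_eq_zero := fun u v h₁ h₂ h₃ h₄ =>
              habel u ((hmem u).mpr ⟨h₁, h₂⟩) v ((hmem v).mpr ⟨h₃, h₄⟩)
            exists_α_lie_ne := by
              by_contra! h
              exact hnonab fun u v => (hmem _).mpr ⟨h u v, hβlie u v⟩
            degenerate := fun u v h₁ h₂ h₃ h₄ h₅ => (hmem _).mp
              ((mem_inf_map_iff hJ.1 _ _ _).mp (hdeg u ((mem_inf_map_iff hJ.1 _ _ _).mpr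
                ⟨(hmem u).mpr ⟨h₁, h₂⟩, (hmem' _).mpr h₃⟩) v ((hmem v).mpr ⟨h₄, h₅⟩))).2 },
    hmem, hmem'⟩

end Frames

theorem stmt12
    {L : Type*} [LieRing L] [LieAlgebra ℝ L] [FiniteDimensional ℝ L]
    (a : LieIdeal ℝ L)
    (habel : ∀ u ∈ a.toSubmodule, ∀ v ∈ a.toSubmodule, ⁅u, v⁆ = (0 : L))
    (hcodim : finrank ℝ ↥a.toSubmodule + 2 = finrank ℝ L)
    (J : L →ₗ[ℝ] L) (hJ : IsComplexStructure J)
    (huni : IsUnimodularLie L)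
    (n : ℕ) (hdim : finrank ℝ L = 2 * n)
    (hJa : a.toSubmodule.map J ≠ a.toSubmodule)
    (hnonab : ¬ ∀ u v : L, ⁅u, v⁆ ∈ a.toSubmodule)
    (aJ a' bb : Submodule ℝ L)
    (haJ : aJ = a.toSubmodule ⊓ a.toSubmodule.map J)
    (ha' : a' = a.toSubmodule ⊔ Submodule.span ℝ {z : L | ∃ u v : L, ⁅u, v⁆ = z})
    (hbb : bb = a.toSubmodule ⊓ a'.map J)
    (hdeg : ∀ u ∈ bb, ∀ v ∈ a.toSubmodule, ⁅J u, v⁆ ∈ aJ)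
    (hplu : ∃ g : HermMetric J, g.IsPluriclosed) :
    (¬ ∀ z : L, ∀ v ∈ a.toSubmodule, ⁅z, v⁆ ∈ bb) ∧
    (∀ x y : L, x ∈ bb → x ∉ aJ → y ∈ a.toSubmodule →
      a.toSubmodule = aJ ⊔ Submodule.span ℝ {x} ⊔ Submodule.span ℝ {y} →
      (∀ (s t : ℝ) (u : L), u ∈ aJ → s • x + t • y + u = 0 → s = 0 ∧ t = 0) →
      ∀ c' d' : ℝ, ⁅J y, y⁆ - (c' • x + d' • y) ∈ aJ → d' ≠ 0) ∧
    ¬ ∃ g : HermMetric J, g.IsBalanced n := by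
  subst haJ ha' hbb
  obtain ⟨F, hmem, hmem'⟩ := exists_degenerateFrame a habel hcodim J hJ hJa hnonab hdeg
  obtain ⟨g, hg⟩ := hplu
  have hd := F.β_J_lie_Jy_y_ne_zero hJ huni hg
  have hbb : ∀ v, v ∈ a.toSubmodule ⊓ (a.toSubmodule ⊔
      Submodule.span ℝ {z : L | ∃ u v : L, ⁅u, v⁆ = z}).map J ↔
      v ∈ a.toSubmodule ∧ F.β (J v) = 0 := fun v => by
    rw [mem_inf_map_iff hJ.1, hmem']
  have hJle : a.toSubmodule ⊓ a.toSubmodule.map J ≤ a.toSubmodule ⊓ (a.toSubmodule ⊔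
      Submodule.span ℝ {z : L | ∃ u v : L, ⁅u, v⁆ = z}).map J :=
    inf_le_inf_left _ (Submodule.map_mono le_sup_left)
  have hy : F.y ∈ a.toSubmodule := (hmem _).mpr ⟨F.α_y, F.β_y⟩
  refine ⟨fun h => hd ((hbb _).mp (h (J F.y) F.y hy)).2, ?_, ?_⟩
  · rintro x y hx - hya ha - c' d' hcd rfl
    have hlie : F.β (J ⁅J y, y⁆) = 0 := by
      have h := add_mem (hJle hcd) (Submodule.smul_mem _ c' hx)
      rw [zero_smul, add_zero, sub_add_cancel] at h
      exact ((hbb _).mp h).2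
    rw [F.β_J_lie_eq hJ, ((hmem y).mp hya).2, zero_mul, sub_zero] at hlie
    have hy0 : F.β (J y) = 0 :=
      mul_self_eq_zero.mp ((mul_eq_zero.mp hlie).resolve_left hd)
    have hle : a.toSubmodule ≤ a.toSubmodule ⊓ (a.toSubmodule ⊔
        Submodule.span ℝ {z : L | ∃ u v : L, ⁅u, v⁆ = z}).map J := by
      conv_lhs => rw [ha]
      refine sup_le (sup_le hJle ?_) ?_
      · rwa [Submodule.span_singleton_le_iff_mem]
      · rw [Submodule.span_singleton_le_iff_mem]
        exact (hbb y).mpr ⟨hya, hy0⟩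
    exact one_ne_zero (F.β_Jy.symm.trans ((hbb _).mp (hle hy)).2)
  · rintro ⟨g', hg'⟩
    exact hd (F.β_J_lie_Jy_y_eq_zero_of_isBalanced hJ huni hdim hg')
end
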